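/- arXiv:1309.2174 — 3 statements merged into one kernel-verified Lean document; each statement's English description precedes it below -/
import Mathlib

section
/- Let X be a real Banach space which is Asplund (every closed separable linear subspace of X has a separable dual), let G ⊆ X be open, and let f : G → ℝ be continuous and approximately convex on G. Then the set N_F(f) of all points of G at which f is not Fréchet differentiable is cone small. -/
open Set Metric Filter Topology

/-- The α-cone `C(x*, α) = {x : α‖x‖·‖x*‖ < x*(x)}` for a functional `x*` on a real
normed space. -/
def ConeSet {E : Type*} [NormedAddCommGroup E] [NormedSpace ℝ E]
    (f : E →L[ℝ] ℝ) (α : ℝ) : Set E :=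
  {x : E | α * ‖x‖ * ‖f‖ < f x}

/-- `A` is α-cone porous at `x`: there is `R > 0` such that for each `ε > 0` there are
`z ∈ U(x,ε)` and `x* ≠ 0` with `U(x,R) ∩ (z + C(x*,α)) ∩ A = ∅`. -/
def ConePorousAt {E : Type*} [NormedAddCommGroup E] [NormedSpace ℝ E]
    (α : ℝ) (A : Set E) (x : E) : Prop :=
  ∃ R > (0 : ℝ), ∀ ε > (0 : ℝ), ∃ z ∈ Metric.ball x ε, ∃ f : E →L[ℝ] ℝ, f ≠ 0 ∧
    Metric.ball x R ∩ ((z + ·) '' ConeSet f α) ∩ A = ∅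

/-- `A` is α-cone porous if it is α-cone porous at each of its points. -/
def ConePorous {E : Type*} [NormedAddCommGroup E] [NormedSpace ℝ E]
    (α : ℝ) (A : Set E) : Prop :=
  ∀ x ∈ A, ConePorousAt α A x

/-- `A` is σ-α-cone porous if it is a countable union of α-cone porous sets. -/
def SigmaConePorous {E : Type*} [NormedAddCommGroup E] [NormedSpace ℝ E]
    (α : ℝ) (A : Set E) : Prop :=
  ∃ g : ℕ → Set E, (∀ n, ConePorous α (g n)) ∧ A = ⋃ n, g n

/-- `A` is cone small if it is σ-α-cone porous for every `α ∈ (0,1)`. -/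
def ConeSmall {E : Type*} [NormedAddCommGroup E] [NormedSpace ℝ E] (A : Set E) : Prop :=
  ∀ α : ℝ, α ∈ Set.Ioo (0 : ℝ) 1 → SigmaConePorous α A


universe u

/-- Limits of quotients. -/
lemma exists_limit_of_almost_mono (q : ℝ → ℝ) (a b : ℝ) (d : ℝ) (hd : 0 < d)
    (hb : ∀ t, 0 < t → t < d → q t ∈ Set.Icc a b)
    (hm : ∀ ε > (0:ℝ), ∃ r > (0:ℝ), ∀ s t, 0 < s → s ≤ t → t < r → q s ≤ q t + ε) :
    ∃ l, Tendsto q (𝓝[>] (0:ℝ)) (𝓝 l) := by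
  have hev : ∀ r > (0:ℝ), ∀ᶠ t in 𝓝[>] (0:ℝ), 0 < t ∧ t < r := fun r hr => Ioo_mem_nhdsGT hr
  have h1 : map q (𝓝[>] (0:ℝ)) ≤ 𝓟 (Set.Icc a b) := by
    rw [le_principal_iff, mem_map]
    filter_upwards [hev d hd] with t ht using hb t ht.1 ht.2
  obtain ⟨l, -, hl⟩ := isCompact_Icc h1
  have hl' : ∀ ε > (0:ℝ), ∃ᶠ t in 𝓝[>] (0:ℝ), |q t - l| < ε := by
    intro ε hε
    have : MapClusterPt l (𝓝[>] (0:ℝ)) q := hl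
    have := this.frequently (p := fun y => |y - l| < ε) (by
      have := Metric.ball_mem_nhds l hε
      filter_upwards [this] with y hy
      rwa [Metric.mem_ball, Real.dist_eq] at hy)
    exact this
  refine ⟨l, Metric.tendsto_nhds.2 fun ε hε => ?_⟩
  obtain ⟨r, hr, hr'⟩ := hm (ε/3) (by positivity)
  obtain ⟨t0, ht0, ht0', ht0''⟩ := ((hl' (ε/3) (by positivity)).and_eventually (hev r hr)).exists
  filter_upwards [hev t0 ht0'] with s hs
  obtain ⟨t1, ht1, ht1', ht1''⟩ := ((hl' (ε/3) (by positivity)).and_eventually (hev s hs.1)).exists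
  have e1 := hr' s t0 hs.1 hs.2.le ht0''
  have e2 := hr' t1 s ht1' ht1''.le (hs.2.trans ht0'')
  rw [abs_lt] at ht0 ht1
  rw [Real.dist_eq, abs_lt]
  constructor <;> linarith

/-- Existence of approximate subgradients. -/
lemma exists_subgrad {X : Type u} [NormedAddCommGroup X] [NormedSpace ℝ X]
    (f : X → ℝ) (z : X) (hf : ContinuousAt f z)
    (hac : ∀ ε > (0 : ℝ), ∃ δ > (0 : ℝ),
      ∀ t ∈ Set.Icc (0 : ℝ) 1, ∀ x ∈ Metric.ball z δ, ∀ y ∈ Metric.ball z δ,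
        f (t • x + (1 - t) • y) ≤ t * f x + (1 - t) * f y + ε * t * (1 - t) * ‖x - y‖) :
    ∃ g : StrongDual ℝ X, ∀ ε > (0:ℝ), ∀ U : Set X, z ∈ U → 
      (∀ t ∈ Set.Icc (0 : ℝ) 1, ∀ x ∈ U, ∀ y ∈ U,
        f (t • x + (1 - t) • y) ≤ t * f x + (1 - t) * f y + ε * t * (1 - t) * ‖x - y‖) →
      ∀ y ∈ U, f z + g (y - z) - ε * ‖y - z‖ ≤ f y := by
  -- quotients
  set q : X → ℝ → ℝ := fun h t => (f (z + t • h) - f z) / t with hq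
  have hmonoU : ∀ ε > (0:ℝ), ∀ U : Set X, z ∈ U → 
      (∀ t ∈ Set.Icc (0 : ℝ) 1, ∀ x ∈ U, ∀ y ∈ U,
        f (t • x + (1 - t) • y) ≤ t * f x + (1 - t) * f y + ε * t * (1 - t) * ‖x - y‖) →
      ∀ h s t, 0 < s → s ≤ t → z + t • h ∈ U → q h s ≤ q h t + ε * ‖h‖ := by
    intro ε hε U hz hU h s t hs hst hy
    have ht : 0 < t := hs.trans_le hst
    have := hU (s/t) ⟨by positivity, by rw [div_le_one ht]; exact hst⟩ _ hy z hz
    have e : (s/t) • (z + t • h) + (1 - s/t) • z = z + s • h := by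
      rw [smul_add, smul_smul, div_mul_cancel₀ _ ht.ne', sub_smul, one_smul]; abel
    rw [e, add_sub_cancel_left, norm_smul, Real.norm_of_nonneg ht.le] at this
    simp only [hq]
    rw [div_le_iff₀ hs, add_mul, div_mul_eq_mul_div]
    have e2 : ε * (s/t) * (1 - s/t) * (t * ‖h‖) ≤ ε * ‖h‖ * s := by
      have : ε * (s/t) * (1 - s/t) * (t * ‖h‖) = ε * ‖h‖ * s * (1 - s/t) := by
        field_simp
      rw [this]
      apply mul_le_of_le_one_right (by positivity)
      have : 0 < s / t := by positivity
      linarith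
    have e3 : (f (z + t • h) - f z) * s / t = s/t * f (z + t • h) - s/t * f z := by ring
    rw [e3]
    linarith
  have hmem : ∀ h t δ, 0 ≤ t → t * ‖h‖ < δ → z + t • h ∈ ball z δ := by
    intro h t δ ht hh
    rw [mem_ball, dist_eq_norm, add_sub_cancel_left, norm_smul, Real.norm_of_nonneg ht]
    exact hh
  have hmono : ∀ ε > (0:ℝ), ∃ δ > (0:ℝ), ∀ h s t, 0 < s → s ≤ t → t * ‖h‖ < δ →
      q h s ≤ q h t + ε * ‖h‖ := by
    intro ε hε
    obtain ⟨δ, hδ, h⟩ := hac ε hε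
    refine ⟨δ, hδ, fun k s t hs hst hk => ?_⟩
    exact hmonoU ε hε _ (mem_ball_self hδ) h k s t hs hst (hmem _ _ _ (hs.le.trans hst) hk)
  have hsum : ∀ ε > (0:ℝ), ∃ δ > (0:ℝ), ∀ h k t, 0 < t → 2 * t * ‖h‖ < δ → 2 * t * ‖k‖ < δ →
      q (h + k) t ≤ q h (2 * t) + q k (2 * t) + ε * ‖h - k‖ := by
    intro ε hε
    obtain ⟨δ, hδ, H⟩ := hac ε hε
    refine ⟨δ, hδ, fun h k t ht hh hk => ?_⟩
    have := H (1/2) ⟨by norm_num, by norm_num⟩ _ (hmem h (2*t) δ (by positivity) hh) _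
      (hmem k (2*t) δ (by positivity) hk)
    have e : (1/2 : ℝ) • (z + (2*t) • h) + (1 - 1/2 : ℝ) • (z + (2*t) • k) = z + t • (h + k) := by
      module
    have e' : (z + (2*t) • h) - (z + (2*t) • k) = (2 * t) • (h - k) := by module
    rw [e, e', norm_smul, Real.norm_of_nonneg (by positivity)] at this
    simp only [hq]
    rw [div_le_iff₀ ht]
    have e3 : ((f (z + (2 * t) • h) - f z) / (2 * t) + (f (z + (2 * t) • k) - f z) / (2 * t) + ε * ‖h - k‖) * t
      = 1/2 * f (z + (2 * t) • h) + 1/2 * f (z + (2 * t) • k) - f z + ε * t * ‖h-k‖ := by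
      field_simp; ring
    rw [e3]
    have : 0 ≤ ε * t * ‖h - k‖ := by positivity
    linarith
  -- limits
  have hlim : ∀ h, ∃ l, Tendsto (q h) (𝓝[>] (0:ℝ)) (𝓝 l) := by
    intro h
    obtain ⟨d1, hd1, H1⟩ := hmono 1 one_pos
    obtain ⟨d2, hd2, H2⟩ := hsum 1 one_pos
    obtain ⟨τ, hτ, hτ1⟩ : ∃ τ > (0:ℝ), 2 * τ * ‖h‖ < min d1 d2 := by
      have hm : 0 < min d1 d2 := lt_min hd1 hd2
      refine ⟨min d1 d2 / (2 * (‖h‖ + 1)), by positivity, ?_⟩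
      have : 2 * (min d1 d2 / (2 * (‖h‖ + 1))) * ‖h‖ = min d1 d2 * (‖h‖ / (‖h‖ + 1)) := by
        field_simp
      rw [this]
      apply mul_lt_of_lt_one_right hm
      rw [div_lt_one (by positivity)]
      linarith
    have hτ2 : 2 * τ * ‖h‖ < d1 := hτ1.trans_le (min_le_left _ _)
    have hτ3 : 2 * τ * ‖h‖ < d2 := hτ1.trans_le (min_le_right _ _)
    refine exists_limit_of_almost_mono (q h) (- (q (-h) (2*τ) + 1 * ‖-h‖) - 1 * ‖h - -h‖)
      (q h (2*τ) + 1 * ‖h‖) (2 * τ) (by positivity) ?_ ?_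
    · intro t ht htτ
      refine ⟨?_, H1 h t _ ht htτ.le hτ2⟩
      have a1 := H1 (-h) t _ ht htτ.le (by rwa [norm_neg])
      have hle : t * ‖h‖ ≤ 2 * τ * ‖h‖ := by gcongr
      have a2 := H2 h (-h) (t/2) (by positivity) (by linarith) (by rw [norm_neg]; linarith)
      have e : q (h + -h) (t/2) = 0 := by simp [hq]
      rw [e] at a2
      have e' : 2 * (t/2) = t := by ring
      rw [e'] at a2
      linarith
    · intro ε hε
      obtain ⟨δ, hδ, H⟩ := hmono (ε / (‖h‖ + 1)) (by positivity)
      refine ⟨δ / (‖h‖ + 1), by positivity, fun s t hs hst ht => ?_⟩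
      rw [lt_div_iff₀ (by positivity)] at ht
      have := H h s t hs hst (by nlinarith [hs.trans_le hst])
      have e : ε / (‖h‖ + 1) * ‖h‖ ≤ ε := by
        rw [div_mul_eq_mul_div, div_le_iff₀ (by positivity)]
        nlinarith
      linarith
  choose p hp using hlim
  have hscale : ∀ c > (0:ℝ), Tendsto (fun t : ℝ => c * t) (𝓝[>] 0) (𝓝[>] 0) := by
    intro c hc
    apply tendsto_nhdsWithin_of_tendsto_nhds_of_eventually_within
    · have : Tendsto (fun t : ℝ => c * t) (𝓝 0) (𝓝 (c * 0)) := (continuous_const_mul c).tendsto 0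
      rw [mul_zero] at this
      exact this.mono_left nhdsWithin_le_nhds
    · filter_upwards [self_mem_nhdsWithin] with t ht
      exact mul_pos hc ht
  have hhom : ∀ c : ℝ, 0 < c → ∀ h, p (c • h) = c * p h := by
    intro c hc h
    refine tendsto_nhds_unique (hp (c • h)) ?_
    have := ((hp h).comp (hscale c hc)).const_mul c
    refine this.congr' ?_
    filter_upwards [self_mem_nhdsWithin] with t ht
    have ht : 0 < t := ht
    simp only [hq, Function.comp, smul_smul, mul_comm t c]
    field_simp
  have hsmall : ∀ c : ℝ, ∀ δ > (0:ℝ), ∀ᶠ t in 𝓝[>] (0:ℝ), 2 * t * c < δ := by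
    intro c δ hδ
    have : Tendsto (fun t : ℝ => 2 * t * c) (𝓝 0) (𝓝 (2 * 0 * c)) := by
      apply Continuous.tendsto; fun_prop
    simp only [mul_zero, zero_mul] at this
    exact (this.mono_left nhdsWithin_le_nhds).eventually_lt_const hδ
  have hadd : ∀ h k, p (h + k) ≤ p h + p k := by
    intro h k
    have key : ∀ ε > (0:ℝ), p (h + k) ≤ p h + p k + ε * ‖h - k‖ := by
      intro ε hε
      obtain ⟨δ, hδ, H⟩ := hsum ε hε
      refine le_of_tendsto_of_tendsto (hp (h+k)) ((((hp h).comp (hscale 2 two_pos)).add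
        ((hp k).comp (hscale 2 two_pos))).add_const _) ?_
      filter_upwards [self_mem_nhdsWithin, hsmall ‖h‖ δ hδ, hsmall ‖k‖ δ hδ] with t ht h1 h2
      exact H h k t ht h1 h2
    refine le_of_forall_pos_le_add fun ε hε => ?_
    have := key (ε / (‖h - k‖ + 1)) (by positivity)
    have e : ε / (‖h - k‖ + 1) * ‖h - k‖ ≤ ε := by
      rw [div_mul_eq_mul_div, div_le_iff₀ (by positivity)]
      nlinarith
    linarith
  have hp0 : p 0 = 0 := by
    refine tendsto_nhds_unique (hp 0) ?_
    simp [hq]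
  -- boundedness
  obtain ⟨C, hC⟩ : ∃ C, ∀ h, p h ≤ C * ‖h‖ := by
    obtain ⟨d1, hd1, H1⟩ := hmono 1 one_pos
    obtain ⟨d2, hd2, H2⟩ := Metric.continuousAt_iff.1 hf 1 one_pos
    set r := min d1 d2 / 2 with hr
    have hm : 0 < min d1 d2 := lt_min hd1 hd2
    have hr0 : 0 < r := by positivity
    have hr1 : r < d1 := by have := min_le_left d1 d2; linarith
    have hr2 : r < d2 := by have := min_le_right d1 d2; linarith
    refine ⟨1 / r + 1, fun h => ?_⟩
    rcases eq_or_ne h 0 with rfl | hh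
    · simp [hp0]
    have hh : 0 < ‖h‖ := norm_pos_iff.2 hh
    have hb : q h (r / ‖h‖) ≤ 1 / r * ‖h‖ := by
      simp only [hq]
      have : f (z + (r / ‖h‖) • h) - f z < 1 := by
        have := H2 (x := z + (r / ‖h‖) • h) (hmem _ _ _ (by positivity) (by
          rw [div_mul_cancel₀ _ hh.ne']; exact hr2))
        rw [Real.dist_eq] at this
        exact (abs_lt.1 this).2
      rw [div_le_iff₀ (by positivity)]
      have : 1 / r * ‖h‖ * (r / ‖h‖) = 1 := by field_simp
      linarith
    refine le_of_tendsto (hp h) ?_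
    filter_upwards [Ioo_mem_nhdsGT (show (0:ℝ) < r / ‖h‖ by positivity)] with t ht
    have := H1 h t (r / ‖h‖) ht.1 ht.2.le (by rw [div_mul_cancel₀ _ hh.ne']; exact hr1)
    linarith
  obtain ⟨g, -, hg⟩ := exists_extension_of_le_sublinear (⟨⊥, 0⟩ : X →ₗ.[ℝ] ℝ) p hhom hadd (by
    rintro ⟨x, hx⟩
    have : x = 0 := by simpa using hx
    subst this
    simp [hp0])
  have hgb : ∀ x, ‖g x‖ ≤ C * ‖x‖ := by
    intro x
    rw [Real.norm_eq_abs, abs_le]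
    have h1 := (hg x).trans (hC x)
    have h2 := (hg (-x)).trans (hC (-x))
    rw [map_neg, norm_neg] at h2
    constructor <;> linarith
  refine ⟨g.mkContinuous C hgb, fun ε hε U hz hU y hy => ?_⟩
  have h1 : p (y - z) ≤ q (y - z) 1 + ε * ‖y - z‖ := by
    refine le_of_tendsto (hp (y - z)) ?_
    filter_upwards [Ioo_mem_nhdsGT (zero_lt_one (α := ℝ))] with t ht
    exact hmonoU ε hε U hz hU _ t 1 ht.1 ht.2.le (by simpa using hy)
  have h2 : q (y - z) 1 = f y - f z := by simp [hq]
  have h3 := hg (y - z)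
  rw [LinearMap.mkContinuous_apply]
  linarith


/-- Weak-star fragmentability of weak-star compact sets in duals of Asplund spaces. -/
lemma exists_small_open {X : Type u} [NormedAddCommGroup X] [NormedSpace ℝ X]
    (hAsp : ∀ V : Subspace ℝ X, IsClosed (V : Set X) →
      TopologicalSpace.SeparableSpace V →
      TopologicalSpace.SeparableSpace (StrongDual ℝ V))
    (K : Set (WeakDual ℝ X)) (hK : IsCompact K) (hne : K.Nonempty) (ε : ℝ) (hε : 0 < ε) :
    ∃ O : Set (WeakDual ℝ X), IsOpen O ∧ (O ∩ K).Nonempty ∧ ∀ p ∈ O ∩ K, ∀ q ∈ O ∩ K,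
      ‖WeakDual.toStrongDual p - WeakDual.toStrongDual q‖ ≤ ε := by
  by_contra hcon
  push Not at hcon
  let S := {O : Set (WeakDual ℝ X) // IsOpen O ∧ (O ∩ K).Nonempty}
  have step : ∀ s : S, ∃ (v : X) (c d : ℝ) (T : Bool → S), ‖v‖ ≤ 1 ∧ c + ε / 2 ≤ d ∧
      (∀ b, (T b).1 ⊆ s.1) ∧ (∀ p ∈ (T true).1, d ≤ p v) ∧ (∀ p ∈ (T false).1, p v ≤ c) := by
    rintro ⟨O, hO, hOK⟩
    obtain ⟨p, hp, q, hq, hpq⟩ := hcon O hO hOK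
    obtain ⟨v, hv, hv'⟩ : ∃ v : X, ‖v‖ ≤ 1 ∧ ε < p v - q v := by
      obtain ⟨v, hv, hv'⟩ := ContinuousLinearMap.exists_lt_apply_of_lt_opNorm _ hpq
      have e : (WeakDual.toStrongDual p - WeakDual.toStrongDual q) v = p v - q v := rfl
      rw [e, Real.norm_eq_abs, lt_abs] at hv'
      rcases hv' with h | h
      · exact ⟨v, hv.le, h⟩
      · refine ⟨-v, by rw [norm_neg]; exact hv.le, ?_⟩
        rw [map_neg, map_neg]; linarith
    have hcont : Continuous (fun r : WeakDual ℝ X => r v) := WeakDual.eval_continuous v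
    refine ⟨v, q v + ε/4, p v - ε/4, fun b => if b then
      ⟨O ∩ {r | p v - ε/4 < r v}, hO.inter (isOpen_lt continuous_const hcont), p, ⟨hp.1, ?_⟩, hp.2⟩
      else ⟨O ∩ {r | r v < q v + ε/4}, hO.inter (isOpen_lt hcont continuous_const), q,
        ⟨hq.1, ?_⟩, hq.2⟩, hv, by linarith, ?_, ?_, ?_⟩
    · simp only [mem_ofPred_eq]; linarith
    · simp only [mem_ofPred_eq]; linarith
    · intro b; cases b
      · exact inter_subset_left
      · exact inter_subset_left
    · intro r hr
      exact le_of_lt hr.2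
    · intro r hr
      exact le_of_lt hr.2
  choose v c d T hv hcd hsub hT hF using step
  let s0 : S := ⟨univ, isOpen_univ, by simpa using hne⟩
  let node : List Bool → S := fun l => List.rec s0 (fun b _ s => T s b) l
  have node_cons : ∀ b l, node (b :: l) = T (node l) b := fun b l => rfl
  let path : (ℕ → Bool) → ℕ → List Bool := fun σ n => Nat.rec [] (fun n l => σ n :: l) n
  have path_succ : ∀ σ n, path σ (n+1) = σ n :: path σ n := fun σ n => rfl
  have path_congr : ∀ σ τ n, (∀ k < n, σ k = τ k) → path σ n = path τ n := by
    intro σ τ n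
    induction n with
    | zero => intro _; rfl
    | succ n ih =>
      intro h
      rw [path_succ, path_succ, h n (Nat.lt_succ_self n), ih fun k hk => h k (hk.trans (Nat.lt_succ_self n))]
  have hlim : ∀ σ, ∃ p : WeakDual ℝ X, ∀ n, p ∈ closure ((node (path σ n)).1 ∩ K) := by
    intro σ
    have := IsCompact.nonempty_iInter_of_sequence_nonempty_isCompact_isClosed
      (fun n => closure ((node (path σ n)).1 ∩ K))
      (fun n => closure_mono (inter_subset_inter_left _ (by
        rw [path_succ, node_cons]; exact hsub _ _)))
      (fun n => (node (path σ n)).2.2.closure)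
      (hK.of_isClosed_subset isClosed_closure
        (closure_minimal inter_subset_right hK.isClosed))
      (fun n => isClosed_closure)
    obtain ⟨p, hp⟩ := this
    exact ⟨p, fun n => mem_iInter.1 hp n⟩
  choose P hP using hlim
  let V : Submodule ℝ X := (Submodule.span ℝ (range fun l => v (node l))).topologicalClosure
  have hVc : IsClosed (V : Set X) := Submodule.isClosed_topologicalClosure _
  have hVs : TopologicalSpace.SeparableSpace V := by
    apply TopologicalSpace.IsSeparable.separableSpace
    change TopologicalSpace.IsSeparable (closure _)
    exact (TopologicalSpace.IsSeparable.span (countable_range _).isSeparable).closure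
  have hVd := hAsp V hVc hVs
  have hvV : ∀ l, v (node l) ∈ V := fun l =>
    Submodule.le_topologicalClosure _ (Submodule.subset_span ⟨l, rfl⟩)
  let Q : (ℕ → Bool) → StrongDual ℝ V := fun σ => (WeakDual.toStrongDual (P σ)).comp V.subtypeL
  have hcl1 : ∀ σ n, σ n = true → d (node (path σ n)) ≤ P σ (v (node (path σ n))) := by
    intro σ n h
    have h1 := hP σ (n+1)
    rw [path_succ, node_cons, h] at h1
    have : closure ((T (node (path σ n)) true).1 ∩ K) ⊆
        {p : WeakDual ℝ X | d (node (path σ n)) ≤ p (v (node (path σ n)))} :=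
      closure_minimal (fun p hp => hT _ p hp.1)
        (isClosed_le continuous_const (WeakDual.eval_continuous _))
    exact this h1
  have hcl2 : ∀ σ n, σ n = false → P σ (v (node (path σ n))) ≤ c (node (path σ n)) := by
    intro σ n h
    have h1 := hP σ (n+1)
    rw [path_succ, node_cons, h] at h1
    have : closure ((T (node (path σ n)) false).1 ∩ K) ⊆
        {p : WeakDual ℝ X | p (v (node (path σ n))) ≤ c (node (path σ n))} :=
      closure_minimal (fun p hp => hF _ p hp.1)
        (isClosed_le (WeakDual.eval_continuous _) continuous_const)
    exact this h1
  have hsep' : ∀ σ τ n, (∀ k < n, σ k = τ k) → σ n = true → τ n = false →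
      ε / 2 ≤ ‖Q σ - Q τ‖ := by
    intro σ τ n hk h1 h2
    have e := path_congr σ τ n hk
    have a1 := hcl1 σ n h1
    have a2 := hcl2 τ n h2
    rw [← e] at a2
    have a3 := hcd (node (path σ n))
    have a4 := (Q σ - Q τ).le_opNorm ⟨_, hvV (path σ n)⟩
    have a5 : (Q σ - Q τ) ⟨_, hvV (path σ n)⟩ =
      P σ (v (node (path σ n))) - P τ (v (node (path σ n))) := rfl
    rw [a5] at a4
    have a6 : ‖(⟨_, hvV (path σ n)⟩ : V)‖ ≤ 1 := hv _
    have a7 := le_abs_self (P σ (v (node (path σ n))) - P τ (v (node (path σ n))))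
    rw [← Real.norm_eq_abs] at a7
    have a8 := mul_le_of_le_one_right (norm_nonneg (Q σ - Q τ)) a6
    linarith
  have hsep : ∀ σ τ, σ ≠ τ → ε / 2 ≤ ‖Q σ - Q τ‖ := by
    intro σ τ hne
    have hex : ∃ n, σ n ≠ τ n := Function.ne_iff.1 hne
    classical
    have hn := Nat.find_spec hex
    have hlt : ∀ k < Nat.find hex, σ k = τ k := fun k hk => not_not.1 (Nat.find_min hex hk)
    rcases hs : σ (Nat.find hex) with _ | _
    · refine le_trans (hsep' τ σ _ (fun k hk => (hlt k hk).symm) ?_ hs) (norm_sub_rev (Q τ) (Q σ)).le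
      rw [hs] at hn
      simpa using hn.symm
    · refine hsep' σ τ _ hlt hs ?_
      rw [hs] at hn
      simpa using hn.symm
  have hcount : Countable (ℕ → Bool) := by
    refine Pairwise.countable_of_isOpen_disjoint (s := fun σ => ball (Q σ) (ε/4)) ?_
      (fun _ => isOpen_ball) (fun σ => ⟨Q σ, mem_ball_self (by positivity)⟩)
    intro σ τ hne
    apply ball_disjoint_ball
    have h1 := (hsep σ τ hne).trans (dist_eq_norm (Q σ) (Q τ)).ge
    linarith
  obtain ⟨enum, henum⟩ := exists_surjective_nat (ℕ → Bool)
  obtain ⟨n, hn⟩ := henum (fun k => !(enum k k))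
  have := congrFun hn n
  simp at this

/-- Well-ordered slicing of a weak-star compact set. -/
lemma exists_ordinal_cover {X : Type u} [NormedAddCommGroup X] [NormedSpace ℝ X]
    (hAsp : ∀ V : Subspace ℝ X, IsClosed (V : Set X) →
      TopologicalSpace.SeparableSpace V →
      TopologicalSpace.SeparableSpace (StrongDual ℝ V))
    (K : Set (WeakDual ℝ X)) (hK : IsCompact K) (ε : ℝ) (hε : 0 < ε) :
    ∃ W : Ordinal.{u} → Set (WeakDual ℝ X), (∀ ξ, IsOpen (W ξ)) ∧ (K ⊆ ⋃ ξ, W ξ) ∧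
      ∀ ξ, ∀ p ∈ W ξ ∩ K, ∀ q ∈ W ξ ∩ K, (∀ η < ξ, p ∉ W η) → (∀ η < ξ, q ∉ W η) →
      ‖WeakDual.toStrongDual p - WeakDual.toStrongDual q‖ ≤ ε := by
  classical
  have key : ∀ U : Set (WeakDual ℝ X), ∃ O : Set (WeakDual ℝ X), IsOpen O ∧ (IsOpen U →
      (K \ U).Nonempty → (O ∩ (K \ U)).Nonempty) ∧ (IsOpen U → ∀ p ∈ O ∩ (K \ U), ∀ q ∈ O ∩ (K \ U),
      ‖WeakDual.toStrongDual p - WeakDual.toStrongDual q‖ ≤ ε) := by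
    intro U
    by_cases h : IsOpen U ∧ (K \ U).Nonempty
    · obtain ⟨O, h1, h2, h3⟩ := exists_small_open hAsp (K \ U) (hK.diff h.1) h.2 ε hε
      exact ⟨O, h1, fun _ _ => h2, fun _ => h3⟩
    · refine ⟨∅, isOpen_empty, fun h1 h2 => (h ⟨h1, h2⟩).elim, by simp⟩
  choose F hF1 hF2 hF3 using key
  let W : Ordinal.{u} → Set (WeakDual ℝ X) := 
    WellFounded.fix (C := fun _ => Set (WeakDual ℝ X)) (wellFounded_lt (α := Ordinal.{u}))
      (fun ξ w => F (⋃ (η : Ordinal.{u}) (h : η < ξ), w η h))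
  have hW : ∀ ξ, W ξ = F (⋃ (η : Ordinal.{u}) (_ : η < ξ), W η) := fun ξ =>
    WellFounded.fix_eq _ _ _
  have hWo : ∀ ξ, IsOpen (W ξ) := fun ξ => by rw [hW]; exact hF1 _
  have hUo : ∀ ξ : Ordinal.{u}, IsOpen (⋃ (η : Ordinal.{u}) (_ : η < ξ), W η) := fun ξ =>
    isOpen_iUnion fun η => isOpen_iUnion fun _ => hWo η
  refine ⟨W, hWo, ?_, ?_⟩
  · by_contra hcon
    rw [not_subset] at hcon
    obtain ⟨p, hpK, hp⟩ := hcon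
    have hp : ∀ ξ, p ∉ W ξ := by simpa using hp
    have h : ∀ ξ : Ordinal.{u}, ∃ a, a ∈ W ξ ∧ ∀ η < ξ, a ∉ W η := by
      intro ξ
      obtain ⟨a, ha1, ha2⟩ := hF2 _ (hUo ξ) ⟨p, hpK, by simp [hp]⟩
      rw [← hW] at ha1
      refine ⟨a, ha1, ?_⟩
      simpa using ha2.2
    choose a ha1 ha2 using h
    refine not_injective_of_ordinal a fun ξ η h => ?_
    rcases lt_trichotomy ξ η with hlt | rfl | hlt
    · exact (ha2 η ξ hlt (h ▸ ha1 ξ)).elim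
    · rfl
    · exact (ha2 ξ η hlt (h ▸ ha1 η)).elim
  · intro ξ p hp q hq hp' hq'
    refine hF3 _ (hUo ξ) p ⟨by rw [← hW]; exact hp.1, hp.2, by simpa using hp'⟩ q
      ⟨by rw [← hW]; exact hq.1, hq.2, by simpa using hq'⟩

/-- Countable decomposition with an almost constant selector. -/
lemma exists_decomp {X : Type u} [NormedAddCommGroup X] [NormedSpace ℝ X]
    (hAsp : ∀ V : Subspace ℝ X, IsClosed (V : Set X) →
      TopologicalSpace.SeparableSpace V →
      TopologicalSpace.SeparableSpace (StrongDual ℝ V))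
    (K : Set (WeakDual ℝ X)) (hK : IsCompact K) (ε : ℝ) (hε : 0 < ε)
    (E : Set X) (Φ : X → Set (WeakDual ℝ X)) (hΦK : ∀ x ∈ E, Φ x ⊆ K)
    (hΦne : ∀ x ∈ E, (Φ x).Nonempty)
    (hΦcl : ∀ x ∈ E, ∀ p ∈ K, p ∉ Φ x → ∃ N ∈ 𝓝 x, ∃ O ∈ 𝓝 p, ∀ y ∈ N ∩ E, ∀ q ∈ O, q ∉ Φ y) :
    ∃ (s : X → WeakDual ℝ X) (e : ℕ → Set X), (∀ x ∈ E, s x ∈ Φ x) ∧ E = ⋃ j, e j ∧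
      ∀ j, ∀ x ∈ e j, ∀ y ∈ e j, dist x y < 1 / ((j:ℝ) + 1) →
        ‖WeakDual.toStrongDual (s x) - WeakDual.toStrongDual (s y)‖ ≤ ε := by
  obtain ⟨W, hWo, hWK, hWs⟩ := exists_ordinal_cover hAsp K hK ε hε
  -- upper semicontinuity
  have husc : ∀ x ∈ E, ∀ O : Set (WeakDual ℝ X), IsOpen O → Φ x ⊆ O →
      ∃ r > (0:ℝ), ∀ y ∈ E, dist y x < r → Φ y ⊆ O := by
    intro x hx O hO hsub
    have hc : IsCompact (K \ O) := hK.diff hO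
    have : ∀ p ∈ K \ O, ∃ t ∈ 𝓝[K \ O] p, ∃ N ∈ 𝓝 x, ∀ y ∈ N ∩ E, ∀ q ∈ t, q ∉ Φ y := by
      intro p hp
      obtain ⟨N, hN, O', hO', h⟩ := hΦcl x hx p hp.1 (fun h => hp.2 (hsub h))
      exact ⟨O', mem_nhdsWithin_of_mem_nhds hO', N, hN, h⟩
    have hfin : ∃ N ∈ 𝓝 x, ∀ y ∈ N ∩ E, ∀ q ∈ K \ O, q ∉ Φ y := by
      refine hc.induction_on (p := fun t => ∃ N ∈ 𝓝 x, ∀ y ∈ N ∩ E, ∀ q ∈ t, q ∉ Φ y)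
        ⟨univ, univ_mem, by simp⟩ ?_ ?_ this
      · rintro s t hst ⟨N, hN, h⟩
        exact ⟨N, hN, fun y hy q hq => h y hy q (hst hq)⟩
      · rintro s t ⟨N, hN, h⟩ ⟨N', hN', h'⟩
        refine ⟨N ∩ N', inter_mem hN hN', fun y hy q hq => ?_⟩
        rcases hq with hq | hq
        · exact h y ⟨hy.1.1, hy.2⟩ q hq
        · exact h' y ⟨hy.1.2, hy.2⟩ q hq
    obtain ⟨N, hN, h⟩ := hfin
    obtain ⟨r, hr, hrN⟩ := Metric.mem_nhds_iff.1 hN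
    refine ⟨r, hr, fun y hy hd q hq => ?_⟩
    by_contra hqO
    exact h y ⟨hrN hd, hy⟩ q ⟨hΦK y hy hq, hqO⟩ hq
  -- compact values
  have hcomp : ∀ x ∈ E, IsCompact (Φ x) := by
    intro x hx
    refine hK.of_isClosed_subset ?_ (hΦK x hx)
    rw [← isOpen_compl_iff, isOpen_iff_mem_nhds]
    intro p hp
    by_cases hpK : p ∈ K
    · obtain ⟨N, hN, O', hO', h⟩ := hΦcl x hx p hpK hp
      filter_upwards [hO'] with q hq
      exact h x ⟨mem_of_mem_nhds hN, hx⟩ q hq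
    · filter_upwards [hK.isClosed.isOpen_compl.mem_nhds hpK] with q hq hq'
      exact hq (hΦK x hx hq')
  have hmax : ∀ x ∈ E, ∀ I : Set Ordinal.{u}, Φ x ⊆ (⋃ η ∈ I, W η) →
      ∃ ξ ∈ I, Φ x ⊆ ⋃ (η : Ordinal.{u}) (_ : η ≤ ξ), W η := by
    intro x hx I hI
    obtain ⟨b, hbI, hbf, hb⟩ := (hcomp x hx).elim_finite_subcover_image (fun i _ => hWo i) hI
    have hbne : b.Nonempty := by
      obtain ⟨p, hp⟩ := hΦne x hx
      have := hb hp
      simp only [mem_iUnion] at this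
      obtain ⟨i, hi, -⟩ := this
      exact ⟨i, hi⟩
    obtain ⟨ξ, hξ, hmx⟩ := hbf.exists_maximal hbne
    refine ⟨ξ, hbI hξ, hb.trans ?_⟩
    intro p hp
    simp only [mem_iUnion] at hp ⊢
    obtain ⟨i, hi, hpi⟩ := hp
    exact ⟨i, (le_total i ξ).elim id (fun h => hmx hi h), hpi⟩
  have hrank : ∀ x, ∃ ξ : Ordinal.{u}, x ∈ E → (Φ x ⊆ ⋃ (η : Ordinal.{u}) (_ : η ≤ ξ), W η) ∧
      ∃ p ∈ Φ x, p ∈ W ξ ∧ ∀ η < ξ, p ∉ W η := by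
    intro x
    by_cases hx : x ∈ E
    swap
    · exact ⟨0, fun h => (hx h).elim⟩
    let A : Set Ordinal.{u} := {ξ | Φ x ⊆ ⋃ (η : Ordinal.{u}) (_ : η ≤ ξ), W η}
    have hA : A.Nonempty := by
      obtain ⟨ξ, -, h⟩ := hmax x hx univ (by simpa using (hΦK x hx).trans hWK)
      exact ⟨ξ, h⟩
    have wf := wellFounded_lt (α := Ordinal.{u})
    refine ⟨wf.min A hA, fun _ => ⟨wf.min_mem A hA, ?_⟩⟩
    have hnot : ¬ Φ x ⊆ ⋃ η ∈ Iio (wf.min A hA), W η := by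
      intro h
      obtain ⟨ξ, h1, h2⟩ := hmax x hx _ h
      exact wf.not_lt_min A (x := ξ) h2 h1
    rw [not_subset] at hnot
    obtain ⟨p, hp, hpn⟩ := hnot
    have hpn : ∀ η < wf.min A hA, p ∉ W η := by simpa using hpn
    refine ⟨p, hp, ?_, hpn⟩
    have := wf.min_mem A hA hp
    simp only [mem_iUnion] at this
    obtain ⟨η, hη, hpη⟩ := this
    rcases hη.lt_or_eq with h | h
    · exact (hpn η h hpη).elim
    · rwa [← h]
  choose ρ hρ using hrank
  have hs : ∀ x, ∃ p, x ∈ E → p ∈ Φ x ∧ p ∈ W (ρ x) ∧ ∀ η < ρ x, p ∉ W η := by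
    intro x
    by_cases hx : x ∈ E
    · obtain ⟨p, h⟩ := (hρ x hx).2
      exact ⟨p, fun _ => h⟩
    · exact ⟨0, fun h => (hx h).elim⟩
  choose s hs using hs
  refine ⟨s, fun j => {x ∈ E | ∀ y ∈ E, dist y x < 1 / ((j:ℝ) + 1) → ρ y ≤ ρ x},
    fun x hx => (hs x hx).1, ?_, ?_⟩
  · ext x
    simp only [mem_iUnion, mem_ofPred_eq]
    refine ⟨fun hx => ?_, fun ⟨_, h, _⟩ => h⟩
    obtain ⟨r, hr, h⟩ := husc x hx (⋃ (η : Ordinal.{u}) (_ : η ≤ ρ x), W η)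
      (isOpen_iUnion fun η => isOpen_iUnion fun _ => hWo η) (hρ x hx).1
    obtain ⟨j, hj⟩ := exists_nat_one_div_lt hr
    refine ⟨j, hx, fun y hy hd => ?_⟩
    have h1 := h y hy (hd.trans hj) (hs y hy).1
    simp only [mem_iUnion] at h1
    obtain ⟨η, hη, h2⟩ := h1
    by_contra hlt
    exact (hs y hy).2.2 η (hη.trans_lt (not_le.1 hlt)) h2
  · rintro j x ⟨hx, hx'⟩ y ⟨hy, hy'⟩ hd
    have e : ρ x = ρ y := le_antisymm (hy' x hx hd) (hx' y hy (by rwa [dist_comm]))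
    refine hWs (ρ x) _ ⟨(hs x hx).2.1, hΦK x hx (hs x hx).1⟩ _
      ⟨e ▸ (hs y hy).2.1, hΦK y hy (hs y hy).1⟩ (hs x hx).2.2 (e ▸ (hs y hy).2.2)

/-- Points where `f` is not differentiable up to `c`. -/
def NonDiffUpTo {X : Type u} [NormedAddCommGroup X] [NormedSpace ℝ X]
    (f : X → ℝ) (c : ℝ) (x : X) : Prop :=
  ∀ g : StrongDual ℝ X, ∀ δ > (0:ℝ), ∃ h : X, ‖h‖ < δ ∧ c * ‖h‖ < |f (x + h) - f x - g h|

lemma not_differentiableAt_iff {X : Type u} [NormedAddCommGroup X] [NormedSpace ℝ X]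
    (f : X → ℝ) (x : X) :
    ¬ DifferentiableAt ℝ f x ↔ ∃ n : ℕ, NonDiffUpTo f (1 / ((n:ℝ) + 1)) x := by
  constructor
  · intro hnd
    by_contra hcon
    simp only [NonDiffUpTo] at hcon
    push Not at hcon
    choose g δ hδ hg using hcon
    have hb : ∀ n m, ‖g n - g m‖ ≤ 1 / ((n:ℝ) + 1) + 1 / ((m:ℝ) + 1) := by
      intro n m
      refine ContinuousLinearMap.opNorm_le_of_ball (lt_min (hδ n) (hδ m)) (by positivity) ?_
      intro h hh
      rw [mem_ball_zero_iff, lt_min_iff] at hh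
      have h1 := abs_le.1 (hg n h hh.1)
      have h2 := abs_le.1 (hg m h hh.2)
      rw [sub_apply, Real.norm_eq_abs, abs_le, add_mul]
      constructor <;> linarith
    have hb2 : ∀ n m N : ℕ, N ≤ n → N ≤ m → dist (g n) (g m) ≤ 2 * (1 / ((N:ℝ) + 1)) := by
      intro n m N hn hm
      refine (dist_eq_norm (g n) (g m)).le.trans ((hb n m).trans ?_)
      have h1 : 1 / ((n:ℝ) + 1) ≤ 1 / ((N:ℝ) + 1) := by gcongr
      have h2 : 1 / ((m:ℝ) + 1) ≤ 1 / ((N:ℝ) + 1) := by gcongr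
      linarith
    have ht : Tendsto (fun N : ℕ => 2 * (1 / ((N:ℝ) + 1))) atTop (𝓝 0) := by
      simpa using (tendsto_one_div_add_atTop_nhds_zero_nat (𝕜 := ℝ)).const_mul 2
    obtain ⟨G, hG⟩ := cauchySeq_tendsto_of_complete (cauchySeq_of_le_tendsto_0 _ hb2 ht)
    have hGn : ∀ n, ‖g n - G‖ ≤ 2 * (1 / ((n:ℝ) + 1)) := by
      intro n
      refine (dist_eq_norm (g n) G).ge.trans ?_
      refine le_of_tendsto (tendsto_const_nhds.dist hG) ?_
      filter_upwards [eventually_ge_atTop n] with m hm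
      exact hb2 n m n le_rfl hm
    apply hnd
    refine HasFDerivAt.differentiableAt (f' := G) ?_
    rw [hasFDerivAt_iff_isLittleO_nhds_zero, Asymptotics.isLittleO_iff]
    intro ε hε
    obtain ⟨n, hn⟩ := exists_nat_one_div_lt (show 0 < ε / 3 by positivity)
    filter_upwards [Metric.ball_mem_nhds (0:X) (hδ n)] with h hh
    rw [mem_ball_zero_iff] at hh
    have h1 := abs_le.1 (hg n h hh)
    have h2 := ((g n - G).le_opNorm h).trans (mul_le_mul_of_nonneg_right (hGn n) (norm_nonneg h))
    rw [sub_apply, Real.norm_eq_abs, abs_le] at h2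
    have h3 : 1 / ((n:ℝ) + 1) * ‖h‖ ≤ ε / 3 * ‖h‖ :=
      mul_le_mul_of_nonneg_right hn.le (norm_nonneg h)
    rw [Real.norm_eq_abs, abs_le]
    constructor <;> linarith
  · rintro ⟨n, hn⟩ hd
    have := hd.hasFDerivAt
    rw [hasFDerivAt_iff_isLittleO_nhds_zero, Asymptotics.isLittleO_iff] at this
    have := this (c := 1 / ((n:ℝ) + 1)) (by positivity)
    obtain ⟨δ, hδ, h⟩ := Metric.eventually_nhds_iff_ball.1 this
    obtain ⟨k, hk, hk'⟩ := hn (fderiv ℝ f x) δ hδ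
    have := h k (by rwa [mem_ball_zero_iff])
    rw [Real.norm_eq_abs] at this
    linarith

theorem approx_convex_frechet_diff_outside_cone_small
    {X : Type*} [NormedAddCommGroup X] [NormedSpace ℝ X] [CompleteSpace X]
    (hAsp : ∀ V : Subspace ℝ X, IsClosed (V : Set X) →
      TopologicalSpace.SeparableSpace V →
      TopologicalSpace.SeparableSpace (StrongDual ℝ V))
    (G : Set X) (hG : IsOpen G) (f : X → ℝ) (hf : ContinuousOn f G)
    (hac : ∀ x0 ∈ G, ∀ ε > (0 : ℝ), ∃ δ > (0 : ℝ), Metric.ball x0 δ ⊆ G ∧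
      ∀ t ∈ Set.Icc (0 : ℝ) 1, ∀ x ∈ Metric.ball x0 δ, ∀ y ∈ Metric.ball x0 δ,
        f (t • x + (1 - t) • y) ≤ t * f x + (1 - t) * f y + ε * t * (1 - t) * ‖x - y‖) :
    ConeSmall {x ∈ G | ¬ DifferentiableAt ℝ f x} := by
  rintro α ⟨hα0, hα1⟩
  have hfc : ∀ x ∈ G, ContinuousAt f x := fun x hx => hf.continuousAt (hG.mem_nhds hx)
  have hsub : ∀ z ∈ G, ∃ g : StrongDual ℝ X, ∀ ε > (0:ℝ), ∀ U : Set X, z ∈ U → 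
      (∀ t ∈ Set.Icc (0 : ℝ) 1, ∀ x ∈ U, ∀ y ∈ U,
        f (t • x + (1 - t) • y) ≤ t * f x + (1 - t) * f y + ε * t * (1 - t) * ‖x - y‖) →
      ∀ y ∈ U, f z + g (y - z) - ε * ‖y - z‖ ≤ f y := by
    intro z hz
    refine exists_subgrad f z (hfc z hz) fun ε hε => ?_
    obtain ⟨δ, hδ, -, h⟩ := hac z hz ε hε
    exact ⟨δ, hδ, h⟩
  let c : ℕ → ℝ := fun n => 1 / ((n:ℝ) + 1)
  have hc : ∀ n, 0 < c n := fun n => by positivity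
  let η : ℕ → ℝ := fun n => α * c n / 5
  have hη : ∀ n, 0 < η n := fun n => by have := hc n; positivity
  let K : ℕ → Set (WeakDual ℝ X) := fun m => WeakDual.toStrongDual ⁻¹' closedBall 0 (m:ℝ)
  have hK : ∀ m, IsCompact (K m) := fun m => WeakDual.isCompact_closedBall 0 (m:ℝ)
  have hKb : ∀ m, ∀ p ∈ K m, ∀ v, |p v| ≤ m * ‖v‖ := by
    intro m p hp v
    have h1 : ‖WeakDual.toStrongDual p‖ ≤ m := mem_closedBall_zero_iff.1 hp
    have h2 := ((WeakDual.toStrongDual p).le_opNorm v).trans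
      (mul_le_mul_of_nonneg_right h1 (norm_nonneg v))
    exact h2
  let Φ : ℕ → ℕ → X → Set (WeakDual ℝ X) := fun n m x =>
    {p | p ∈ K m ∧ ∀ y ∈ ball x (c m), f x + p (y - x) - η n * ‖y - x‖ ≤ f y}
  let E : ℕ → ℕ → Set X := fun n m => {x | x ∈ G ∧ (Φ n m x).Nonempty}
  have hcover : ∀ n, ∀ x ∈ G, ∃ m, x ∈ E n m := by
    intro n x hx
    obtain ⟨g, hg⟩ := hsub x hx
    obtain ⟨δ, hδ, -, h⟩ := hac x hx (η n) (hη n)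
    obtain ⟨m1, hm1⟩ := exists_nat_one_div_lt hδ
    obtain ⟨m2, hm2⟩ := exists_nat_ge ‖g‖
    refine ⟨max m1 m2, hx, StrongDual.toWeakDual g, ?_, ?_⟩
    · change g ∈ closedBall (0 : StrongDual ℝ X) _
      rw [mem_closedBall_zero_iff]
      refine hm2.trans ?_
      exact_mod_cast le_max_right m1 m2
    · intro y hy
      refine hg (η n) (hη n) _ (mem_ball_self hδ) h y (ball_subset_ball ?_ hy)
      refine le_trans ?_ hm1.le
      simp only [c]
      have : (m1:ℝ) ≤ ((max m1 m2 : ℕ) : ℝ) := by exact_mod_cast le_max_left m1 m2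
      gcongr
  have hdec := fun n m => exists_decomp hAsp (K m) (hK m) (η n) (hη n) (E n m) (Φ n m)
    (fun x _ p hp => hp.1) (fun x hx => hx.2) (by
      intro x hx p hp hpn
      have : ∃ y ∈ ball x (c m), f y < f x + p (y - x) - η n * ‖y - x‖ := by
        by_contra hcon
        push Not at hcon
        exact hpn ⟨hp, hcon⟩
      obtain ⟨y, hy, hlt⟩ := this
      set γ := f x + p (y - x) - η n * ‖y - x‖ - f y with hγ
      have hγ0 : 0 < γ := by linarith
      have hcont : ContinuousAt (fun x' => f x' - m * ‖x - x'‖ - η n * ‖y - x'‖) x := by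
        have := hfc x hx.1
        fun_prop
      have hN1 : ∀ᶠ x' in 𝓝 x, f x - η n * ‖y - x‖ - γ / 2 <
          f x' - m * ‖x - x'‖ - η n * ‖y - x'‖ := by
        refine hcont.eventually_const_lt ?_
        simp only [sub_self, norm_zero, mul_zero, sub_zero]
        linarith
      have hN2 : ∀ᶠ x' in 𝓝 x, dist y x' < c m :=
        ((continuous_const.dist continuous_id).continuousAt).eventually_lt_const hy
      refine ⟨_, hN1.and hN2, {q | p (y - x) - γ / 2 < q (y - x)},
        (isOpen_lt continuous_const (WeakDual.eval_continuous _)).mem_nhds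
          (show p (y - x) - γ / 2 < p (y - x) by linarith), ?_⟩
      rintro x' ⟨⟨h1, h2⟩, -⟩ q hq hqΦ
      have h3 := hqΦ.2 y h2
      have h4 := (abs_le.1 (hKb m q hqΦ.1 (x - x'))).1
      have h5 : q (y - x') = q (y - x) + q (x - x') := by rw [← map_add]; congr 1; abel
      have hq : p (y - x) - γ / 2 < q (y - x) := hq
      rw [h5] at h3
      linarith)
  choose s e hs he hse using hdec
  let A : ℕ × ℕ × ℕ → Set X := fun i => {x | NonDiffUpTo f (c i.1) x ∧ x ∈ e i.1 i.2.1 i.2.2}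
  refine ⟨fun k => A ((Denumerable.eqv (ℕ × ℕ × ℕ)).symm k), ?_, ?_⟩
  · intro k
    change ConePorous α (A ((Denumerable.eqv (ℕ × ℕ × ℕ)).symm k))
    generalize (Denumerable.eqv (ℕ × ℕ × ℕ)).symm k = i
    obtain ⟨n, m, j⟩ := i
    have heE : ∀ x ∈ e n m j, x ∈ E n m := fun x hx => by
      rw [he n m]; exact mem_iUnion.2 ⟨j, hx⟩
    rintro x ⟨hxN, hxe⟩
    have hxN : NonDiffUpTo f (c n) x := hxN
    have hxe : x ∈ e n m j := hxe
    have hxE := heE x hxe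
    obtain ⟨δ, hδ, hδG, hconv⟩ := hac x hxE.1 (η n) (hη n)
    have hcm := hc m
    have hcj := hc j
    refine ⟨min δ (min (c m / 2) (c j)), by positivity, fun ε hε => ?_⟩
    obtain ⟨h, hh, hbig⟩ := hxN (WeakDual.toStrongDual (s n m x)) (min ε (min δ (c m / 2)))
      (by positivity)
    rw [lt_min_iff, lt_min_iff] at hh
    obtain ⟨hhε, hhδ, hhm⟩ := hh
    have hηc : η n ≤ c n / 5 := by
      have := hc n
      simp only [η]
      nlinarith
    have hsx := hs n m x hxE
    have hzx : ∀ r, ‖h‖ < r → x + h ∈ ball x r := fun r hr => by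
      rw [mem_ball, dist_eq_norm, add_sub_cancel_left]; exact hr
    have hlow := hsx.2 (x + h) (hzx _ (by linarith))
    rw [add_sub_cancel_left] at hlow
    have hup : c n * ‖h‖ < f (x + h) - f x - s n m x h := by
      have hbig : c n * ‖h‖ < |f (x + h) - f x - s n m x h| := hbig
      rcases lt_abs.1 hbig with h1 | h1
      · exact h1
      · exfalso
        have : η n * ‖h‖ ≤ c n * ‖h‖ :=
          mul_le_mul_of_nonneg_right (by linarith [hc n]) (norm_nonneg h)
        linarith
    have hzG : x + h ∈ G := hδG (hzx _ hhδ)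
    obtain ⟨g, hg⟩ := hsub (x + h) hzG
    have hg := hg (η n) (hη n) (ball x δ) (hzx _ hhδ) hconv
    have hgx := hg x (mem_ball_self hδ)
    have ex : x - (x + h) = -h := by abel
    rw [ex, map_neg, norm_neg] at hgx
    have hh0 : 0 < ‖h‖ := by
      rw [norm_pos_iff]
      rintro rfl
      simp at hup
    set F : StrongDual ℝ X := g - WeakDual.toStrongDual (s n m x) with hF
    have hFapp : ∀ w, F w = g w - s n m x w := fun w => rfl
    have hFh : (c n - η n) * ‖h‖ ≤ F h := by
      rw [hFapp, sub_mul]; linarith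
    have hFn : c n - η n ≤ ‖F‖ := by
      have h1 := (le_abs_self _).trans (F.le_opNorm h)
      exact le_of_mul_le_mul_right (hFh.trans h1) hh0
    have hcn := hc n
    refine ⟨x + h, hzx _ hhε, F, ?_, ?_⟩
    · intro h0
      rw [h0, norm_zero] at hFn
      linarith
    · rw [eq_empty_iff_forall_notMem]
      rintro y ⟨⟨hyR, w, hw, hwy⟩, -, hye⟩
      have hye : y ∈ e n m j := hye
      have hyE := heE y hye
      rw [mem_ball, lt_min_iff, lt_min_iff] at hyR
      obtain ⟨hyδ, hym, hyj⟩ := hyR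
      have hwy : x + h + w = y := hwy
      have hw : α * ‖w‖ * ‖F‖ < F w := hw
      have hsy := hs n m y hyE
      have e1 : y - (x + h) = w := by rw [← hwy]; abel
      have e2 : (x + h) - y = -w := by rw [← hwy]; abel
      have i1 := hsy.2 (x + h) (by
        rw [mem_ball]
        have := dist_triangle (x + h) x y
        rw [dist_comm x y] at this
        have h2 : dist (x + h) x < c m / 2 := hzx _ hhm
        linarith)
      rw [e2, map_neg, norm_neg] at i1
      have i2 := hg y hyδ
      rw [e1] at i2
      have i3 := hse n m j y hye x hxe hyj
      have i4 := (WeakDual.toStrongDual (s n m y) - WeakDual.toStrongDual (s n m x)).le_opNorm w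
      have i5 := (le_abs_self _).trans (i4.trans (mul_le_mul_of_nonneg_right i3 (norm_nonneg w)))
      have i5 : s n m y w - s n m x w ≤ η n * ‖w‖ := i5
      have i6 : F w ≤ 3 * η n * ‖w‖ := by
        rw [hFapp]; linarith
      have i7 : 3 * η n ≤ α * ‖F‖ := by
        have : α * (c n - η n) ≤ α * ‖F‖ := mul_le_mul_of_nonneg_left hFn hα0.le
        have h8 : α * (c n - c n / 5) ≤ α * (c n - η n) :=
          mul_le_mul_of_nonneg_left (by linarith) hα0.le
        have h9 : 3 * η n ≤ α * (c n - c n / 5) := by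
          have : 0 < α * c n := by positivity
          simp only [η]
          linarith
        linarith
      have i8 := mul_le_mul_of_nonneg_right i7 (norm_nonneg w)
      linarith
  · ext x
    rw [mem_iUnion]
    constructor
    · rintro ⟨hx, hnd⟩
      obtain ⟨n, hn⟩ := (not_differentiableAt_iff f x).1 hnd
      obtain ⟨m, hm⟩ := hcover n x hx
      have hm' := hm
      rw [he n m] at hm'
      obtain ⟨j, hj⟩ := mem_iUnion.1 hm'
      refine ⟨Denumerable.eqv (ℕ × ℕ × ℕ) (n, m, j), ?_⟩
      simp only [Equiv.symm_apply_apply]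
      exact ⟨hn, hj⟩
    · rintro ⟨k, hk⟩
      change x ∈ A ((Denumerable.eqv (ℕ × ℕ × ℕ)).symm k) at hk
      generalize (Denumerable.eqv (ℕ × ℕ × ℕ)).symm k = i at hk
      obtain ⟨n, m, j⟩ := i
      obtain ⟨h1, h2⟩ := hk
      have h3 : x ∈ E n m := by rw [he n m]; exact mem_iUnion.2 ⟨j, h2⟩
      exact ⟨h3.1, (not_differentiableAt_iff f x).2 ⟨n, h1⟩⟩
end

section
/- Let X be a real Banach space which is Asplund (every closed separable linear subspace of X has a separable dual), let G ⊆ X be open, and let g : G → X* be a LAN (locally almost nonincreasing) mapping. Then the set of points of G at which g is not norm-to-norm continuous is cone small. -/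
open Set Metric Filter Topology

/-- `g : G → X*` is LAN (locally almost nonincreasing): for every `a ∈ G` and `ε > 0`
there is `δ > 0` with `⟨g x₁ - g x₂, x₁ - x₂⟩ ≤ ε‖x₁ - x₂‖` for `x₁, x₂ ∈ U(a,δ) ∩ G`. -/
def IsLAN {X : Type*} [NormedAddCommGroup X] [NormedSpace ℝ X]
    (G : Set X) (g : X → (X →L[ℝ] ℝ)) : Prop :=
  ∀ a ∈ G, ∀ ε > (0 : ℝ), ∃ δ > (0 : ℝ),
    ∀ x₁ ∈ Metric.ball a δ ∩ G, ∀ x₂ ∈ Metric.ball a δ ∩ G,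
      (g x₁ - g x₂) (x₁ - x₂) ≤ ε * ‖x₁ - x₂‖

section porosity
variable {E : Type*} [NormedAddCommGroup E] [NormedSpace ℝ E]

theorem ConePorous.mono {α : ℝ} {A B : Set E} (h : ConePorous α B) (hAB : A ⊆ B) :
    ConePorous α A := by
  intro x hx
  obtain ⟨R, hR, H⟩ := h x (hAB hx)
  refine ⟨R, hR, fun ε hε => ?_⟩
  obtain ⟨z, hz, f, hf, he⟩ := H ε hε
  refine ⟨z, hz, f, hf, ?_⟩
  rw [← subset_empty_iff] at he ⊢
  exact fun w hw => he ⟨hw.1, hAB hw.2⟩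

theorem SigmaConePorous.mono {α : ℝ} {A B : Set E} (h : SigmaConePorous α B) (hAB : A ⊆ B) :
    SigmaConePorous α A := by
  obtain ⟨s, hs, rfl⟩ := h
  refine ⟨fun n => A ∩ s n, fun n => (hs n).mono inter_subset_right, ?_⟩
  rw [← inter_iUnion]
  exact (inter_eq_left.2 hAB).symm

theorem ConePorous.sigma {α : ℝ} {A : Set E} (h : ConePorous α A) : SigmaConePorous α A :=
  ⟨fun _ => A, fun _ => h, (iUnion_const A).symm⟩

theorem sigma_iUnion {ι : Type*} [Countable ι] {α : ℝ} {A : ι → Set E}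
    (h : ∀ i, SigmaConePorous α (A i)) : SigmaConePorous α (⋃ i, A i) := by
  choose s hs hA using h
  rcases isEmpty_or_nonempty ι with hι | hι
  · refine ⟨fun _ => ∅, fun n x hx => hx.elim, by simp⟩
  · obtain ⟨e, he⟩ := exists_surjective_nat (ι × ℕ)
    refine ⟨fun n => s (e n).1 (e n).2, fun n => hs _ _, ?_⟩
    ext x
    simp only [mem_iUnion, hA]
    constructor
    · rintro ⟨i, j, h⟩
      obtain ⟨n, hn⟩ := he (i, j)
      exact ⟨n, by rw [hn]; exact h⟩
    · rintro ⟨n, h⟩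
      exact ⟨_, _, h⟩

theorem SigmaConePorous.union {α : ℝ} {A B : Set E} (hA : SigmaConePorous α A)
    (hB : SigmaConePorous α B) : SigmaConePorous α (A ∪ B) := by
  rw [union_eq_iUnion]
  exact sigma_iUnion (by rintro (_ | _) <;> assumption)

/-- Localization: a locally σ-porous set is σ-porous. -/
theorem sigma_local {ι : Type*} {α : ℝ} {A : Set E} {O : ι → Set E}
    (hO : ∀ i, IsOpen (O i)) (h : ∀ i, SigmaConePorous α (A ∩ O i)) :
    SigmaConePorous α (A ∩ ⋃ i, O i) := by
  choose s hs hA using h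
  let P : ι → ℕ → Set E := fun i n =>
    {x | (∀ j, WellOrderingRel j i → x ∉ O j) ∧ ball x (1 / ((n : ℝ) + 1)) ⊆ O i}
  have key : SigmaConePorous α (⋃ p : ℕ × ℕ, ⋃ i, P i p.1 ∩ s i p.2) := by
    refine sigma_iUnion fun p => ConePorous.sigma ?_
    rintro x hx
    obtain ⟨i, hxP, hxs⟩ := mem_iUnion.1 hx
    obtain ⟨R, hR, H⟩ := hs i p.2 x hxs
    have hn : (0 : ℝ) < 1 / ((p.1 : ℝ) + 1) := by positivity
    refine ⟨min R (1 / ((p.1 : ℝ) + 1)), lt_min hR hn, fun ε hε => ?_⟩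
    obtain ⟨z, hz, f, hf, he⟩ := H ε hε
    refine ⟨z, hz, f, hf, ?_⟩
    rw [← subset_empty_iff] at he ⊢
    rintro w ⟨⟨hwR, hwC⟩, hw⟩
    obtain ⟨j, hwP, hws⟩ := mem_iUnion.1 hw
    have hd : dist w x < 1 / ((p.1 : ℝ) + 1) := lt_of_lt_of_le hwR (min_le_right _ _)
    have hij : j = i := by
      rcases trichotomous_of WellOrderingRel j i with h | h | h
      · exact (hxP.1 j h (hwP.2 (by rw [mem_ball, dist_comm]; exact hd))).elim
      · exact h
      · exact (hwP.1 i h (hxP.2 hd)).elim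
    subst hij
    exact he ⟨⟨ball_subset_ball (min_le_left _ _) hwR, hwC⟩, hws⟩
  refine key.mono ?_
  rintro x ⟨hxA, hx⟩
  have hne : {i | x ∈ O i}.Nonempty := mem_iUnion.1 hx
  have wf : WellFounded (@WellOrderingRel ι) := IsWellFounded.wf
  let i := wf.min _ hne
  have hi : x ∈ O i := wf.min_mem _ hne
  have hmin : ∀ j, WellOrderingRel j i → x ∉ O j := fun j hj hxj =>
    wf.not_lt_min _ hxj hj
  obtain ⟨r, hr, hb⟩ := Metric.isOpen_iff.1 (hO i) x hi
  obtain ⟨n, hn⟩ := exists_nat_one_div_lt hr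
  have hxs : x ∈ ⋃ k, s i k := by rw [← hA]; exact ⟨hxA, hi⟩
  obtain ⟨k, hk⟩ := mem_iUnion.1 hxs
  exact mem_iUnion.2 ⟨(n, k), mem_iUnion.2 ⟨i, ⟨hmin, (ball_subset_ball hn.le).trans hb⟩, hk⟩⟩

end porosity

section frag
variable {X : Type*} [NormedAddCommGroup X] [NormedSpace ℝ X]

theorem frag_step {L : Set (WeakDual ℝ X)} {η : ℝ}
    (U : Set (WeakDual ℝ X)) (hU : IsOpen U)
    (h : ∃ φ ∈ U ∩ L, ∃ ψ ∈ U ∩ L, η < ‖WeakDual.toStrongDual φ - WeakDual.toStrongDual ψ‖)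
    (hη : 0 < η) :
    ∃ (x : X) (C : Bool → Set (WeakDual ℝ X)), x ≠ 0 ∧
      (∀ b, IsOpen (C b) ∧ (C b ∩ L).Nonempty ∧ C b ⊆ U) ∧
      ∀ θ ∈ closure (C true), ∀ θ' ∈ closure (C false), η * ‖x‖ ≤ θ x - θ' x := by
  obtain ⟨φ, hφ, ψ, hψ, hd⟩ := h
  obtain ⟨x, hx⟩ : ∃ x, η * ‖x‖ < φ x - ψ x := by
    by_contra hcon
    push Not at hcon
    refine absurd hd (not_lt.2 (ContinuousLinearMap.opNorm_le_bound _ hη.le fun x => ?_))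
    have h1 := hcon x
    have h2 := hcon (-x)
    rw [norm_neg, map_neg, map_neg] at h2
    change |φ x - ψ x| ≤ _
    rw [abs_le]
    constructor <;> linarith
  set s := (φ x - ψ x - η * ‖x‖) / 2 with hs
  have hs0 : 0 < s := by rw [hs]; linarith
  have hc : Continuous fun θ : WeakDual ℝ X => θ x := WeakDual.eval_continuous x
  refine ⟨x, fun b => cond b (U ∩ {θ | φ x - s < θ x}) (U ∩ {θ | θ x < ψ x + s}), ?_, ?_, ?_⟩
  · rintro rfl
    simp at hx
  · rintro (_ | _)
    · exact ⟨hU.inter (isOpen_lt hc continuous_const),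
        ⟨ψ, ⟨hψ.1, by simpa using hs0⟩, hψ.2⟩, inter_subset_left⟩
    · exact ⟨hU.inter (isOpen_lt continuous_const hc),
        ⟨φ, ⟨hφ.1, by simpa using hs0⟩, hφ.2⟩, inter_subset_left⟩
  · intro θ hθ θ' hθ'
    have h1 : φ x - s ≤ θ x := by
      have : closure (U ∩ {θ : WeakDual ℝ X | φ x - s < θ x}) ⊆ {θ | φ x - s ≤ θ x} :=
        closure_minimal (fun t ht => by
          have := ht.2
          simp only [mem_ofPred_eq] at this ⊢
          exact this.le) (isClosed_le continuous_const hc)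
      exact this hθ
    have h2 : θ' x ≤ ψ x + s := by
      have : closure (U ∩ {θ : WeakDual ℝ X | θ x < ψ x + s}) ⊆ {θ | θ x ≤ ψ x + s} :=
        closure_minimal (fun t ht => by
          have := ht.2
          simp only [mem_ofPred_eq] at this ⊢
          exact this.le) (isClosed_le hc continuous_const)
      exact this hθ'
    linarith

theorem fragment
    (hAsp : ∀ V : Subspace ℝ X, IsClosed (V : Set X) →
      TopologicalSpace.SeparableSpace V →
      TopologicalSpace.SeparableSpace (StrongDual ℝ V))
    {L : Set (WeakDual ℝ X)} (hL : IsCompact L) (hLne : L.Nonempty) {η : ℝ} (hη : 0 < η) :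
    ∃ U : Set (WeakDual ℝ X), IsOpen U ∧ (U ∩ L).Nonempty ∧
      ∀ φ ∈ U ∩ L, ∀ ψ ∈ U ∩ L,
        ‖WeakDual.toStrongDual φ - WeakDual.toStrongDual ψ‖ ≤ η := by
  by_contra hcon
  push Not at hcon
  let S := {U : Set (WeakDual ℝ X) // IsOpen U ∧ (U ∩ L).Nonempty}
  have step : ∀ U : S, ∃ (x : X) (C : Bool → S), x ≠ 0 ∧ (∀ b, (C b).1 ⊆ U.1) ∧
      ∀ θ ∈ closure (C true).1, ∀ θ' ∈ closure (C false).1, η * ‖x‖ ≤ θ x - θ' x := by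
    rintro ⟨U, hU, hUL⟩
    obtain ⟨x, C, hx, hC, h⟩ := frag_step (L := L) U hU (hcon U hU hUL) hη
    exact ⟨x, fun b => ⟨C b, (hC b).1, (hC b).2.1⟩, hx, fun b => (hC b).2.2, h⟩
  choose vec child hvec hsub hsep using step
  let root : S := ⟨univ, isOpen_univ, by simpa using hLne⟩
  let node : List Bool → S := fun l => List.rec root (fun b _ U => child U b) l
  have node_cons : ∀ b l, node (b :: l) = child (node l) b := fun b l => rfl
  have branch : ∀ σ : ℕ → Bool, ∃ θ : WeakDual ℝ X, ∀ n, θ ∈ closure (node (PiNat.res σ n)).1 := by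
    intro σ
    have hne := IsCompact.nonempty_iInter_of_sequence_nonempty_isCompact_isClosed
      (fun n => closure ((node (PiNat.res σ n)).1 ∩ L)) ?_ ?_ ?_ ?_
    · obtain ⟨θ, hθ⟩ := hne
      exact ⟨θ, fun n => closure_mono inter_subset_left (mem_iInter.1 hθ n)⟩
    · intro n
      refine closure_mono (inter_subset_inter_left _ ?_)
      rw [PiNat.res_succ, node_cons]
      exact hsub _ _
    · intro n
      exact (node _).2.2.closure
    · exact hL.of_isClosed_subset isClosed_closure
        (closure_minimal inter_subset_right hL.isClosed)
    · intro n
      exact isClosed_closure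
  choose θ hθ using branch
  let V : Submodule ℝ X := (Submodule.span ℝ (range fun l => vec (node l))).topologicalClosure
  have hVsep : TopologicalSpace.SeparableSpace V := by
    have : TopologicalSpace.IsSeparable (V : Set X) := by
      change TopologicalSpace.IsSeparable (closure _)
      exact ((countable_range _).isSeparable.span).closure
    exact this.separableSpace
  have hD := hAsp V (Submodule.isClosed_topologicalClosure _) hVsep
  have hmem : ∀ l, vec (node l) ∈ V := fun l =>
    Submodule.le_topologicalClosure _ (Submodule.subset_span ⟨l, rfl⟩)
  let Ψ : (ℕ → Bool) → StrongDual ℝ V := fun σ =>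
    (WeakDual.toStrongDual (θ σ)).comp V.subtypeL
  have sep1 : ∀ σ τ : ℕ → Bool, ∀ n, (∀ m < n, σ m = τ m) → σ n = true → τ n = false →
      η ≤ dist (Ψ σ) (Ψ τ) := by
    intro σ τ n hm h1 h2
    have hres : PiNat.res σ n = PiNat.res τ n := PiNat.res_eq_res.2 fun m hm' => hm m hm'
    have a1 := hθ σ (n + 1)
    have a2 := hθ τ (n + 1)
    rw [PiNat.res_succ, node_cons, h1] at a1
    rw [PiNat.res_succ, node_cons, h2, ← hres] at a2
    have := hsep _ _ a1 _ a2
    set x := vec (node (PiNat.res σ n)) with hx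
    have hx0 : 0 < ‖x‖ := norm_pos_iff.2 (hvec _)
    have hle := (Ψ σ - Ψ τ).le_opNorm ⟨x, hmem _⟩
    have e : (Ψ σ - Ψ τ) ⟨x, hmem _⟩ = θ σ x - θ τ x := rfl
    rw [e] at hle
    have e2 : ‖(⟨x, hmem _⟩ : V)‖ = ‖x‖ := rfl
    rw [e2, ← dist_eq_norm (Ψ σ) (Ψ τ)] at hle
    exact le_of_mul_le_mul_right (this.trans ((le_abs_self _).trans hle)) hx0
  have sep : ∀ σ τ : ℕ → Bool, σ ≠ τ → η ≤ dist (Ψ σ) (Ψ τ) := by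
    intro σ τ hne
    have hex : ∃ n, σ n ≠ τ n := Function.ne_iff.1 hne
    classical
    have hn := Nat.find_spec hex
    have hm : ∀ m < Nat.find hex, σ m = τ m := fun m hm => not_not.1 (Nat.find_min hex hm)
    rcases h1 : σ (Nat.find hex) with _ | _
    · rcases h2 : τ (Nat.find hex) with _ | _
      · exact (hn (h1.trans h2.symm)).elim
      · rw [dist_comm]
        exact sep1 τ σ _ (fun m h => (hm m h).symm) h2 h1
    · rcases h2 : τ (Nat.find hex) with _ | _
      · exact sep1 σ τ _ hm h1 h2
      · exact (hn (h1.trans h2.symm)).elim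
  have hcount : Countable (ℕ → Bool) := by
    refine Pairwise.countable_of_isOpen_disjoint (s := fun σ => ball (Ψ σ) (η / 2)) ?_
      (fun _ => isOpen_ball) (fun _ => nonempty_ball.2 (half_pos hη))
    intro σ τ hne
    exact ball_disjoint_ball (by linarith [sep σ τ hne])
  obtain ⟨f, hf⟩ := hcount.exists_injective_nat
  have hf' : Function.Injective fun s : Set ℕ => f (fun n => by classical exact decide (n ∈ s)) := by
    intro s t hst
    have := hf hst
    ext n
    simpa using congrFun this n
  exact Function.cantor_injective _ hf'

end frag

section lan
variable {X : Type*} [NormedAddCommGroup X] [NormedSpace ℝ X]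

theorem lan_locally_bounded [CompleteSpace X] {G : Set X} (hG : IsOpen G)
    {g : X → (X →L[ℝ] ℝ)} (hg : IsLAN G g) {a : X} (ha : a ∈ G) :
    ∃ r > (0 : ℝ), ∃ M : ℝ, ∀ y ∈ ball a r, ‖g y‖ ≤ M := by
  obtain ⟨δ₁, hδ₁, H⟩ := hg a ha 1 one_pos
  obtain ⟨δ₂, hδ₂, hG'⟩ := Metric.isOpen_iff.1 hG a ha
  set δ := min δ₁ δ₂ with hδ
  have hδ0 : 0 < δ := lt_min hδ₁ hδ₂
  have hsub : ball a δ ⊆ ball a δ₁ ∩ G := fun x hx =>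
    ⟨ball_subset_ball (min_le_left _ _) hx, hG' (ball_subset_ball (min_le_right _ _) hx)⟩
  let b : X → ℝ := fun y => 1 + ‖g y‖ * ‖y - a‖
  have hb : ∀ y, 1 ≤ b y := fun y => by
    have : 0 ≤ ‖g y‖ * ‖y - a‖ := by positivity
    simp only [b]; linarith
  -- one sided bound for small directions
  have small : ∀ u : X, ‖u‖ < δ → ∀ y ∈ ball a δ,
      -(g y u) ≤ ((1 + ‖g (a + u)‖) * (2 * δ) + 1) * b y := by
    intro u hu y hy
    have h1 := H y (hsub hy) (a + u) (hsub (by simpa [mem_ball, dist_eq_norm] using hu))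
    have hy' : ‖y - a‖ < δ := by simpa [mem_ball, dist_eq_norm] using hy
    have hn : ‖y - (a + u)‖ ≤ 2 * δ := by
      have : y - (a + u) = (y - a) - u := by abel
      rw [this]
      linarith [norm_sub_le (y - a) u]
    have h2 : g (a + u) (y - (a + u)) ≤ ‖g (a + u)‖ * ‖y - (a + u)‖ :=
      (le_abs_self _).trans ((g (a + u)).le_opNorm _)
    have h3 : -(g y (y - a)) ≤ ‖g y‖ * ‖y - a‖ :=
      (neg_le_abs _).trans ((g y).le_opNorm _)
    have e : (g y - g (a + u)) (y - (a + u)) =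
        g y (y - a) - g y u - g (a + u) (y - (a + u)) := by
      rw [sub_apply]
      congr 1
      rw [← map_sub]
      congr 1
      abel
    rw [e] at h1
    have h4 : (1 + ‖g (a + u)‖) * ‖y - (a + u)‖ ≤ (1 + ‖g (a + u)‖) * (2 * δ) := by gcongr
    have h5 : 0 ≤ (1 + ‖g (a + u)‖) * (2 * δ) := by positivity
    have h6 : (1 + ‖g (a + u)‖) * (2 * δ) * 1 ≤ (1 + ‖g (a + u)‖) * (2 * δ) * b y :=
      mul_le_mul_of_nonneg_left (hb y) h5
    have h7 : b y = 1 + ‖g y‖ * ‖y - a‖ := rfl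
    nlinarith
  have bs := banach_steinhaus (𝕜 := ℝ) (𝕜₂ := ℝ) (σ₁₂ := RingHom.id ℝ)
    (g := fun y : ball a δ => (b y)⁻¹ • g y) ?_
  · obtain ⟨M, hM⟩ := bs
    set M' := max M 1 with hM'
    have hM'0 : 0 < M' := lt_of_lt_of_le one_pos (le_max_right _ _)
    refine ⟨min δ (1 / (2 * M')), lt_min hδ0 (by positivity), 2 * M', fun y hy => ?_⟩
    have hy1 : y ∈ ball a δ := ball_subset_ball (min_le_left _ _) hy
    have hy2 : ‖y - a‖ ≤ 1 / (2 * M') := by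
      have := ball_subset_ball (min_le_right _ _) hy
      rw [mem_ball, dist_eq_norm] at this
      exact this.le
    have hb0 : 0 < b y := lt_of_lt_of_le one_pos (hb y)
    have h1 : ‖(b y)⁻¹ • g y‖ ≤ M' := (hM ⟨y, hy1⟩).trans (le_max_left _ _)
    rw [norm_smul, norm_inv, Real.norm_eq_abs, abs_of_pos hb0, inv_mul_le_iff₀ hb0] at h1
    have h2 : ‖g y‖ * ‖y - a‖ ≤ ‖g y‖ * (1 / (2 * M')) := by gcongr
    have h3 : b y = 1 + ‖g y‖ * ‖y - a‖ := rfl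
    have h4 : b y * M' ≤ (1 + ‖g y‖ * (1 / (2 * M'))) * M' := by rw [h3]; gcongr
    have h5 : (1 + ‖g y‖ * (1 / (2 * M'))) * M' = M' + ‖g y‖ / 2 := by field_simp
    linarith
  · intro u
    -- scale u
    set t : ℝ := δ / (2 * (‖u‖ + 1)) with ht
    have ht0 : 0 < t := by positivity
    have htu : ‖t • u‖ < δ := by
      rw [norm_smul, Real.norm_eq_abs, abs_of_pos ht0, ht, div_mul_eq_mul_div,
        div_lt_iff₀ (by positivity)]
      nlinarith [norm_nonneg u]
    have htu' : ‖t • (-u)‖ < δ := by rw [smul_neg, norm_neg]; exact htu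
    set C1 := (1 + ‖g (a + t • u)‖) * (2 * δ) + 1
    set C2 := (1 + ‖g (a + t • (-u))‖) * (2 * δ) + 1
    refine ⟨max C1 C2 / t, fun y => ?_⟩
    have hb0 : 0 < b y := lt_of_lt_of_le one_pos (hb y)
    have s1 := small _ htu y y.2
    have s2 := small _ htu' y y.2
    rw [map_smul] at s1 s2
    rw [map_neg] at s2
    simp only [smul_eq_mul] at s1 s2
    have s1' : C1 * b y ≤ max C1 C2 * b y := by gcongr; exact le_max_left _ _
    have s2' : C2 * b y ≤ max C1 C2 * b y := by gcongr; exact le_max_right _ _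
    rw [smul_apply, norm_smul, norm_inv, Real.norm_eq_abs, abs_of_pos hb0,
      inv_mul_le_iff₀ hb0, mul_div_assoc', le_div_iff₀ ht0, Real.norm_eq_abs, ← abs_of_pos ht0,
      ← abs_mul, abs_le]
    constructor <;> nlinarith

/-- Closure of the graph of `g` in norm × weak* topology. -/
def graphClosure (g : X → (X →L[ℝ] ℝ)) : Set (X × WeakDual ℝ X) :=
  closure (range fun y => (y, StrongDual.toWeakDual (g y)))

theorem lan_limit {g : X → (X →L[ℝ] ℝ)} {w y : X} {φ : WeakDual ℝ X}
    {m ε : ℝ} {U : Set X} (hU : IsOpen U) (hw : w ∈ U) (hm : ∀ x ∈ U, ‖g x‖ ≤ m)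
    (hl : ∀ x ∈ U, (g x - g y) (x - y) ≤ ε * ‖x - y‖) (hφ : (w, φ) ∈ graphClosure g) :
    (WeakDual.toStrongDual φ - g y) (w - y) ≤ ε * ‖w - y‖ := by
  have h1 : (w, φ) ∈ closure ((U ×ˢ univ) ∩ range fun y => (y, StrongDual.toWeakDual (g y))) :=
    (hU.prod isOpen_univ).inter_closure ⟨⟨hw, trivial⟩, hφ⟩
  have h2 : closure ((U ×ˢ univ) ∩ range fun y => (y, StrongDual.toWeakDual (g y))) ⊆
      {p : X × WeakDual ℝ X |
        p.2 (w - y) ≤ g y (p.1 - y) + ε * ‖p.1 - y‖ + m * ‖w - p.1‖} := by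
    refine closure_minimal ?_ (isClosed_le ?_ ?_)
    · rintro _ ⟨⟨hx, -⟩, x, rfl⟩
      change g x (w - y) ≤ g y (x - y) + ε * ‖x - y‖ + m * ‖w - x‖
      have a1 := hl x hx
      have a2 : g x (w - x) ≤ m * ‖w - x‖ :=
        (le_abs_self _).trans ((g x).le_of_opNorm_le (hm x hx) _)
      have e : g x (w - y) = g x (w - x) + g x (x - y) := by
        rw [← map_add]; congr 1; abel
      rw [sub_apply] at a1
      linarith
    · exact (WeakDual.eval_continuous (w - y)).comp continuous_snd
    · fun_prop
  have h3 := h2 h1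
  simp only [mem_ofPred_eq, sub_self, norm_zero, mul_zero, add_zero] at h3
  rw [sub_apply]
  change φ (w - y) - _ ≤ _
  linarith

/-- points where `g` is locally bounded by `m` -/
def bddPart (G : Set X) (g : X → (X →L[ℝ] ℝ)) (m : ℝ) : Set X :=
  {x | ∃ r > (0 : ℝ), ball x r ⊆ G ∧ ∀ y ∈ ball x r, ‖g y‖ ≤ m}

theorem isOpen_bddPart (G : Set X) (g : X → (X →L[ℝ] ℝ)) (m : ℝ) : IsOpen (bddPart G g m) := by
  rw [Metric.isOpen_iff]
  rintro x ⟨r, hr, h1, h2⟩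
  refine ⟨r, hr, fun y hy => ?_⟩
  obtain ⟨s, hs, hb⟩ := Metric.isOpen_iff.1 isOpen_ball y hy
  exact ⟨s, hs, hb.trans h1, fun z hz => h2 z (hb hz)⟩

/-- weak* closed ball -/
def wBall (X : Type*) [NormedAddCommGroup X] [NormedSpace ℝ X] (m : ℝ) : Set (WeakDual ℝ X) :=
  WeakDual.toStrongDual ⁻¹' closedBall 0 m

/-- points whose limit set inside the ball lies in `W` -/
def oSet (G : Set X) (g : X → (X →L[ℝ] ℝ)) (m : ℝ) (W : Set (WeakDual ℝ X)) : Set X :=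
  bddPart G g m ∩ {x | ∀ φ ∈ wBall X m \ W, (x, φ) ∉ graphClosure g}

theorem isOpen_oSet (G : Set X) (g : X → (X →L[ℝ] ℝ)) (m : ℝ) {W : Set (WeakDual ℝ X)}
    (hW : IsOpen W) : IsOpen (oSet G g m W) := by
  refine (isOpen_bddPart G g m).inter (isOpen_iff_mem_nhds.2 fun x hx => ?_)
  have hK : IsCompact (wBall X m \ W) := (WeakDual.isCompact_closedBall _ _).diff hW
  exact hK.eventually_forall_of_forall_eventually (P := fun x φ => (x, φ) ∉ graphClosure g)
    fun φ hφ => (isClosed_closure (s := range fun y =>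
      (y, StrongDual.toWeakDual (g y)))).isOpen_compl.mem_nhds (hx φ hφ)

/-- points of oscillation at least `2c` -/
def oscSet (G : Set X) (g : X → (X →L[ℝ] ℝ)) (c : ℝ) : Set X :=
  {x ∈ G | ∀ r > (0 : ℝ), ∃ y ∈ ball x r ∩ G, 2 * c ≤ ‖g y - g x‖}

theorem porous_piece {G : Set X} (hG : IsOpen G) {g : X → (X →L[ℝ] ℝ)} (hg : IsLAN G g)
    {α c m : ℝ} (hα : 0 < α) (hc : 0 < c) {W W' : Set (WeakDual ℝ X)}
    (hd : ∀ φ ∈ W' ∩ (wBall X m \ W), ∀ ψ ∈ W' ∩ (wBall X m \ W),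
      ‖WeakDual.toStrongDual φ - WeakDual.toStrongDual ψ‖ ≤ α * c / 2) :
    ConePorous α (oscSet G g c ∩ (oSet G g m (W ∪ W') \ oSet G g m W)) := by
  have pick : ∀ x ∈ oscSet G g c ∩ (oSet G g m (W ∪ W') \ oSet G g m W),
      ∃ φ ∈ W' ∩ (wBall X m \ W), (x, φ) ∈ graphClosure g := by
    rintro x ⟨-, ⟨hb, hx⟩, hx'⟩
    have : ∃ φ ∈ wBall X m \ W, (x, φ) ∈ graphClosure g := by
      by_contra hcon
      push Not at hcon
      exact hx' ⟨hb, hcon⟩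
    obtain ⟨φ, hφ, hφg⟩ := this
    refine ⟨φ, ⟨?_, hφ⟩, hφg⟩
    by_contra hW'
    exact hx φ ⟨hφ.1, fun h => h.elim hφ.2 hW'⟩ hφg
  intro x hx
  obtain ⟨φ, hφ, hφg⟩ := pick x hx
  obtain ⟨R, hR, H⟩ := hg x hx.1.1 (α * c / 2) (by positivity)
  refine ⟨R, hR, fun ε hε => ?_⟩
  obtain ⟨y, ⟨hyb, hyG⟩, hyc⟩ : ∃ y ∈ ball x (min ε R) ∩ G,
      c ≤ ‖WeakDual.toStrongDual φ - g y‖ := by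
    by_contra hcon
    push Not at hcon
    have hpos : 0 < min ε R := lt_min hε hR
    obtain ⟨y, hy, hyo⟩ := hx.1.2 _ hpos
    have a1 := hcon y hy
    have a2 := hcon x ⟨mem_ball_self hpos, hx.1.1⟩
    have e : g y - g x = (WeakDual.toStrongDual φ - g x) - (WeakDual.toStrongDual φ - g y) := by
      abel
    rw [e] at hyo
    linarith [norm_sub_le (WeakDual.toStrongDual φ - g x) (WeakDual.toStrongDual φ - g y)]
  refine ⟨y, ball_subset_ball (min_le_left _ _) hyb, WeakDual.toStrongDual φ - g y,
    norm_pos_iff.1 (hc.trans_le hyc), ?_⟩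
  rw [← subset_empty_iff]
  rintro w ⟨⟨hwR, u, hu, rfl⟩, hw⟩
  obtain ⟨ψ, hψ, hψg⟩ := pick _ hw
  obtain ⟨r, hr, hrG, hrm⟩ := hw.2.1.1
  have hyR : y ∈ ball x R ∩ G := ⟨ball_subset_ball (min_le_right _ _) hyb, hyG⟩
  have hlim := lan_limit (ε := α * c / 2) (y := y) (m := m) (U := ball (y + u) r ∩ ball x R)
    (isOpen_ball.inter isOpen_ball) ⟨mem_ball_self hr, hwR⟩ (fun z hz => hrm z hz.1)
    (fun z hz => H z ⟨hz.2, hrG hz.1⟩ y hyR) hψg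
  rw [add_sub_cancel_left] at hlim
  have hdd := ContinuousLinearMap.le_of_opNorm_le _ (hd φ hφ ψ hψ) u
  have h2 := (le_abs_self _).trans hdd
  change α * ‖u‖ * ‖WeakDual.toStrongDual φ - g y‖ < (WeakDual.toStrongDual φ - g y) u at hu
  have h3 : α * ‖u‖ * c ≤ α * ‖u‖ * ‖WeakDual.toStrongDual φ - g y‖ := by gcongr
  simp only [sub_apply] at *
  exfalso
  linarith

theorem sigma_part
    (hAsp : ∀ V : Subspace ℝ X, IsClosed (V : Set X) →
      TopologicalSpace.SeparableSpace V →
      TopologicalSpace.SeparableSpace (StrongDual ℝ V))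
    {G : Set X} (hG : IsOpen G) {g : X → (X →L[ℝ] ℝ)} (hg : IsLAN G g)
    {α c : ℝ} (m : ℝ) (hα : 0 < α) (hc : 0 < c) :
    SigmaConePorous α (oscSet G g c ∩ bddPart G g m) := by
  have hK : IsCompact (wBall X m) := WeakDual.isCompact_closedBall _ _
  let 𝒲 : Set (Set (WeakDual ℝ X)) :=
    {W | IsOpen W ∧ SigmaConePorous α (oscSet G g c ∩ oSet G g m W)}
  have hempty : ∅ ∈ 𝒲 := by
    · refine ⟨isOpen_empty, (ConePorous.sigma (A := ∅) fun x hx => hx.elim).mono ?_⟩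
      rintro x ⟨-, ⟨r, hr, -, hrm⟩, hx⟩
      refine hx (StrongDual.toWeakDual (g x)) ⟨?_, id⟩ (subset_closure ⟨x, rfl⟩)
      change g x ∈ closedBall 0 m
      simpa using hrm x (mem_ball_self hr)
  have hchains : ∀ C ⊆ 𝒲, IsChain (fun x1 x2 => x1 ⊆ x2) C → C.Nonempty →
      ∃ ub ∈ 𝒲, ∀ s ∈ C, s ⊆ ub := by
    · intro C hC hchain hCne
      refine ⟨⋃₀ C, ⟨isOpen_sUnion fun W hW => (hC hW).1, ?_⟩, fun s hs => subset_sUnion_of_mem hs⟩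
      refine (sigma_local (ι := C) (O := fun W => oSet G g m W.1)
        (fun W => isOpen_oSet G g m (hC W.2).1) (fun W => (hC W.2).2)).mono ?_
      refine inter_subset_inter_right _ ?_
      rintro x ⟨hb, hx⟩
      have hcl : IsClosed {φ | (x, φ) ∈ graphClosure g} :=
        isClosed_closure.preimage (by fun_prop)
      have : Nonempty C := hCne.to_subtype
      have hcov : wBall X m ∩ {φ | (x, φ) ∈ graphClosure g} ⊆ ⋃ W : C, W.1 := by
        rintro φ ⟨h1, h2⟩
        by_contra h3
        rw [← sUnion_eq_iUnion] at h3
        exact hx φ ⟨h1, h3⟩ h2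
      have hdir : Directed (fun x1 x2 => x1 ⊆ x2) fun W : C => W.1 := hchain.directed
      obtain ⟨W, hW⟩ := (hK.inter_right hcl).elim_directed_cover (fun W : C => W.1)
        (fun W => (hC W.2).1) hcov hdir
      exact mem_iUnion.2 ⟨W, hb, fun φ hφ hφg => hφ.2 (hW ⟨hφ.1, hφg⟩)⟩
  obtain ⟨W, -, hW⟩ := zorn_subset_nonempty 𝒲 hchains ∅ hempty
  · have hsub : wBall X m ⊆ W := by
      by_contra hne
      have hLne : (wBall X m \ W).Nonempty := sdiff_nonempty.2 hne
      obtain ⟨W', hW'o, ⟨φ, hφ⟩, hd⟩ := fragment hAsp (hK.diff hW.prop.1) hLne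
        (η := α * c / 2) (by positivity)
      have hp := porous_piece hG hg hα hc hd
      have hmem : W ∪ W' ∈ {W : Set (WeakDual ℝ X) |
          IsOpen W ∧ SigmaConePorous α (oscSet G g c ∩ oSet G g m W)} := by
        refine ⟨hW.prop.1.union hW'o, (hW.prop.2.union hp.sigma).mono ?_⟩
        rintro x ⟨hx1, hx2⟩
        by_cases h : x ∈ oSet G g m W
        · exact Or.inl ⟨hx1, h⟩
        · exact Or.inr ⟨hx1, hx2, h⟩
      exact hφ.2.2 (hW.le_of_ge hmem subset_union_left (Or.inr hφ.1))
    refine hW.prop.2.mono (inter_subset_inter_right _ fun x hx => ⟨hx, fun φ hφ => ?_⟩)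
    exact (hφ.2 (hsub hφ.1)).elim

end lan

/-- A LAN mapping from an open subset of an Asplund space (every closed separable
subspace has separable dual) into the dual is norm-to-norm continuous outside a cone
small set. -/
theorem lan_continuous_outside_cone_small
    {X : Type*} [NormedAddCommGroup X] [NormedSpace ℝ X] [CompleteSpace X]
    (hAsp : ∀ V : Subspace ℝ X, IsClosed (V : Set X) →
      TopologicalSpace.SeparableSpace V →
      TopologicalSpace.SeparableSpace (StrongDual ℝ V))
    (G : Set X) (hG : IsOpen G) (g : X → (X →L[ℝ] ℝ)) (hg : IsLAN G g) :
    ConeSmall {x ∈ G | ¬ ContinuousWithinAt g G x} := by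
  rintro α ⟨hα, -⟩
  have key : SigmaConePorous α
      (⋃ p : ℕ × ℕ, oscSet G g (1 / ((p.1 : ℝ) + 1)) ∩ bddPart G g (p.2 : ℝ)) :=
    sigma_iUnion fun p => sigma_part hAsp hG hg _ hα (by positivity)
  refine key.mono ?_
  rintro x ⟨hxG, hx⟩
  obtain ⟨r, hr, M, hM⟩ := lan_locally_bounded hG hg hxG
  obtain ⟨r', hr', hb⟩ := Metric.isOpen_iff.1 hG x hxG
  obtain ⟨m, hm⟩ := exists_nat_ge M
  have h1 : x ∈ bddPart G g (m : ℝ) :=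
    ⟨min r r', lt_min hr hr', (ball_subset_ball (min_le_right _ _)).trans hb, fun y hy =>
      (hM y (ball_subset_ball (min_le_left _ _) hy)).trans hm⟩
  rw [Metric.continuousWithinAt_iff] at hx
  push Not at hx
  obtain ⟨ε, hε, hosc⟩ := hx
  obtain ⟨n, hn⟩ := exists_nat_one_div_lt (half_pos hε)
  refine mem_iUnion.2 ⟨(n, m), ⟨hxG, fun s hs => ?_⟩, h1⟩
  obtain ⟨y, hyG, hyd, hy⟩ := hosc s hs
  refine ⟨y, ⟨hyd, hyG⟩, ?_⟩
  rw [← dist_eq_norm]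
  change 2 * (1 / ((n : ℝ) + 1)) ≤ _
  linarith
end

section
/- Let X be a real Banach space which is Asplund (every closed separable linear subspace of X has a separable dual) and let A ⊆ X be a Suslin set. Then for every separable linear subspace V0 ⊆ X there exists a closed separable linear subspace V ⊆ X with V0 ⊆ V such that: A is cone small in X if and only if A ∩ V is cone small in the Banach space V (with the induced norm). -/
open Set Metric Filter Topology

/-- The initial segment `ν|n` of an infinite sequence `ν`, as a finite sequence. -/
def seg (ν : ℕ → ℕ) (n : ℕ) : List ℕ := (List.range n).map ν

/-- The Suslin operation applied to a Suslin scheme indexed by finite sequences. -/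
def SuslinOp {X : Type*} (A : List ℕ → Set X) : Set X :=
  ⋃ ν : ℕ → ℕ, ⋂ n : ℕ, A (seg ν n)

/-- A set is Suslin if it is the result of the Suslin operation applied to a scheme
of closed sets. -/
def IsSuslin {X : Type*} [TopologicalSpace X] (S : Set X) : Prop :=
  ∃ A : List ℕ → Set X, (∀ s, IsClosed (A s)) ∧ SuslinOp A = S


section Helpers

set_option linter.unusedSectionVars false

variable {E : Type*} [NormedAddCommGroup E] [NormedSpace ℝ E]

theorem ConePorousAt.mono_set {α : ℝ} {A B : Set E} {x : E} (h : ConePorousAt α A x)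
    (hBA : B ⊆ A) : ConePorousAt α B x := by
  obtain ⟨R, hR, h⟩ := h
  refine ⟨R, hR, fun ε hε => ?_⟩
  obtain ⟨z, hz, f, hf, he⟩ := h ε hε
  refine ⟨z, hz, f, hf, ?_⟩
  exact subset_eq_empty (inter_subset_inter_right _ hBA) he

theorem ConePorous.subset {α : ℝ} {A B : Set E} (h : ConePorous α A)
    (hBA : B ⊆ A) : ConePorous α B := fun x hx => (h x (hBA hx)).mono_set hBA

theorem SigmaConePorous.of_subset_iUnion {α : ℝ} {B : Set E} {g : ℕ → Set E}
    (hg : ∀ n, ConePorous α (g n)) (h : B ⊆ ⋃ n, g n) : SigmaConePorous α B := by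
  refine ⟨fun n => B ∩ g n, fun n => (hg n).subset inter_subset_right, ?_⟩
  rw [← inter_iUnion]
  exact (inter_eq_left.mpr h).symm

theorem SigmaConePorous.subset {α : ℝ} {A B : Set E} (h : SigmaConePorous α A)
    (hBA : B ⊆ A) : SigmaConePorous α B := by
  obtain ⟨g, hg, rfl⟩ := h
  exact .of_subset_iUnion hg hBA

theorem SigmaConePorous.iUnion {α : ℝ} {A : ℕ → Set E} (h : ∀ n, SigmaConePorous α (A n)) :
    SigmaConePorous α (⋃ n, A n) := by
  choose g hg hA using h
  refine .of_subset_iUnion (g := fun k => g k.unpair.1 k.unpair.2) (fun k => hg _ _) ?_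
  intro x hx
  obtain ⟨n, hn⟩ := mem_iUnion.1 hx
  rw [hA n] at hn
  obtain ⟨m, hm⟩ := mem_iUnion.1 hn
  exact mem_iUnion.2 ⟨Nat.pair n m, by simpa using hm⟩

/-- Locally σ-porous implies σ-porous. -/
theorem SigmaConePorous.of_local {α : ℝ} {B : Set E}
    (h : ∀ x ∈ B, ∃ C : Set E, ∃ r > 0, SigmaConePorous α C ∧ C ∩ ball x r = B ∩ ball x r) :
    SigmaConePorous α B := by
  have h' : ∀ x : B, ∃ r > 0, SigmaConePorous α (B ∩ ball x.1 r) := by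
    rintro ⟨x, hx⟩
    obtain ⟨C, r, hr, hC, he⟩ := h x hx
    exact ⟨r, hr, he ▸ hC.subset inter_subset_left⟩
  choose r hr hσ using h'
  choose g hg hgB using hσ
  let S : B → ℕ → Set E := fun i n =>
    {x | ball x (1 / ((n : ℝ) + 1)) ⊆ ball i.1 (r i) ∧
      ∀ j : B, WellOrderingRel j i → x ∉ ball j.1 (r j)}
  have hsep : ∀ n i j x y, x ∈ S i n → y ∈ S j n → dist y x < 1 / ((n : ℝ) + 1) → i = j := by
    intro n i j x y hx hy hd
    rcases trichotomous_of WellOrderingRel i j with hij | hij | hij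
    · exact absurd (hx.1 (mem_ball.2 hd)) (hy.2 i hij)
    · exact hij
    · exact absurd (hy.1 (mem_ball.2 (by rwa [dist_comm]))) (hx.2 j hij)
  let P : ℕ → ℕ → Set E := fun n m => ⋃ i : B, S i n ∩ g i m
  have hP : ∀ n m, ConePorous α (P n m) := by
    intro n m x hx
    obtain ⟨i, hxS, hxg⟩ := mem_iUnion.1 hx
    obtain ⟨R, hR, hpor⟩ := hg i m x hxg
    have hn : 0 < 1 / ((n : ℝ) + 1) := by positivity
    refine ⟨min R (1 / ((n : ℝ) + 1)), lt_min hR hn, fun ε hε => ?_⟩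
    obtain ⟨z, hz, f, hf, he⟩ := hpor ε hε
    refine ⟨z, hz, f, hf, ?_⟩
    rw [eq_empty_iff_forall_notMem] at he ⊢
    rintro y ⟨⟨hy1, hy2⟩, hy3⟩
    obtain ⟨j, hyS, hyg⟩ := mem_iUnion.1 hy3
    have hij : i = j := hsep n i j x y hxS hyS (lt_of_lt_of_le hy1 (min_le_right _ _))
    subst hij
    exact he y ⟨⟨ball_subset_ball (min_le_left _ _) hy1, hy2⟩, hyg⟩
  have : SigmaConePorous α (⋃ n, ⋃ m, P n m) :=
    .iUnion fun n => .iUnion fun m => (hP n m).sigma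
  refine this.subset fun x hx => ?_
  have hne : {i : B | x ∈ ball i.1 (r i)}.Nonempty := ⟨⟨x, hx⟩, mem_ball_self (hr _)⟩
  have wf : WellFounded (WellOrderingRel : B → B → Prop) := WellOrderingRel.isWellOrder.wf
  let i := wf.min _ hne
  have hi : x ∈ ball i.1 (r i) := wf.min_mem _ hne
  have hi2 : ∀ j : B, WellOrderingRel j i → x ∉ ball j.1 (r j) := fun j hj hxj =>
    wf.not_lt_min _ hxj hj
  obtain ⟨δ, hδ, hsub⟩ := Metric.isOpen_iff.1 isOpen_ball x hi
  obtain ⟨n, hn⟩ := exists_nat_one_div_lt hδ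
  have hxg : x ∈ ⋃ m, g i m := by rw [← hgB i]; exact ⟨hx, hi⟩
  obtain ⟨m, hm⟩ := mem_iUnion.1 hxg
  exact mem_iUnion.2 ⟨n, mem_iUnion.2 ⟨m, mem_iUnion.2
    ⟨i, ⟨(ball_subset_ball hn.le).trans hsub, hi2⟩, hm⟩⟩⟩

/-- Points of `B` near which `B` is nowhere σ-porous. -/
def porKer (α : ℝ) (B : Set E) : Set E :=
  {x | x ∈ B ∧ ∀ r > 0, ¬ SigmaConePorous α (B ∩ ball x r)}

theorem sigma_diff_porKer (α : ℝ) (B : Set E) : SigmaConePorous α (B \ porKer α B) := by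
  refine .of_local fun x hx => ?_
  have : ∃ r > 0, SigmaConePorous α (B ∩ ball x r) := by
    by_contra hcon
    push Not at hcon
    exact hx.2 ⟨hx.1, hcon⟩
  obtain ⟨r, hr, h⟩ := this
  exact ⟨(B \ porKer α B) ∩ ball x r, r, hr,
    h.subset (inter_subset_inter_left _ sdiff_subset), by rw [inter_assoc, inter_self]⟩

/-- The part of a Suslin set coming from branches through (the reverse of) `t`. -/
def susSub (A : List ℕ → Set E) (t : List ℕ) : Set E :=
  {x | ∃ ν : ℕ → ℕ, seg ν t.length = t.reverse ∧ ∀ n, x ∈ A (seg ν n)}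

theorem seg_succ (ν : ℕ → ℕ) (n : ℕ) : seg ν (n + 1) = seg ν n ++ [ν n] := by
  simp [seg, List.range_succ]

theorem susSub_cons (A : List ℕ → Set E) (t : List ℕ) {x : E} (hx : x ∈ susSub A t) :
    ∃ k, x ∈ susSub A (k :: t) := by
  obtain ⟨ν, h1, h2⟩ := hx
  refine ⟨ν t.length, ν, ?_, h2⟩
  rw [List.length_cons, seg_succ, h1, List.reverse_cons]

theorem susSub_subset (A : List ℕ → Set E) (t : List ℕ) : susSub A t ⊆ A t.reverse := by
  rintro x ⟨ν, h1, h2⟩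
  rw [← h1]
  exact h2 _

theorem susSub_nil (A : List ℕ → Set E) : susSub A [] = SuslinOp A := by
  ext x
  simp [susSub, SuslinOp, seg]

/-- The tree of sets used in the Foran-type argument. -/
def tr (α : ℝ) (A : List ℕ → Set E) : List ℕ → Set E
  | [] => susSub A []
  | k :: t => {x | x ∈ porKer α (tr α A t) ∧ ¬ ConePorousAt α (porKer α (tr α A t)) x} ∩
      susSub A (k :: t)

theorem tr_subset (α : ℝ) (A : List ℕ → Set E) (t : List ℕ) : tr α A t ⊆ susSub A t := by
  cases t with
  | nil => exact subset_rfl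
  | cons k t => exact inter_subset_right

theorem tr_next (α : ℝ) (A : List ℕ → Set E) (t : List ℕ) {p : E}
    (hp : p ∈ porKer α (tr α A t)) {U : Set E} (hU : IsOpen U) (hpU : p ∈ U) :
    ∃ k, (U ∩ porKer α (tr α A (k :: t))).Nonempty := by
  by_contra! hcon
  obtain ⟨r, hr, hrU⟩ := Metric.isOpen_iff.1 hU p hpU
  apply hp.2 r hr
  have h1 := sigma_diff_porKer α (tr α A t)
  have h2 : SigmaConePorous α
      {x | x ∈ porKer α (tr α A t) ∧ ConePorousAt α (porKer α (tr α A t)) x} := by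
    apply ConePorous.sigma
    intro x hx
    exact hx.2.mono_set fun y hy => hy.1
  have h3 : SigmaConePorous α (⋃ k, tr α A (k :: t) \ porKer α (tr α A (k :: t))) :=
    .iUnion fun k => sigma_diff_porKer α _
  refine ((h1.union h2).union h3).subset ?_
  rintro x ⟨hx, hxr⟩
  by_cases hk : x ∈ porKer α (tr α A t)
  · by_cases hpor : ConePorousAt α (porKer α (tr α A t)) x
    · exact Or.inl (Or.inr ⟨hk, hpor⟩)
    · right
      obtain ⟨k, hxk⟩ := susSub_cons A t (tr_subset α A t hx)
      refine mem_iUnion.2 ⟨k, ⟨⟨hk, hpor⟩, hxk⟩, fun hcc => ?_⟩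
      exact (hcon k).subset ⟨hrU hxr, hcc⟩
  · exact Or.inl (Or.inl ⟨hx, hk⟩)

theorem closing_off (Φ : E → E → E → Set E) (hΦ : ∀ x y z, (Φ x y z).Countable)
    (V₀ : Submodule ℝ E) (hV₀ : TopologicalSpace.SeparableSpace V₀) :
    ∃ V : Submodule ℝ E, IsClosed (V : Set E) ∧ TopologicalSpace.SeparableSpace V ∧ V₀ ≤ V ∧
      ∃ D : Set E, (V : Set E) = closure D ∧ (0 : E) ∈ D ∧
        ∀ x ∈ D, ∀ y ∈ D, ∀ z ∈ D, Φ x y z ⊆ D := by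
  obtain ⟨C, hCc, hCd⟩ := TopologicalSpace.exists_countable_dense V₀
  let D0 : Set E := insert 0 (Subtype.val '' C)
  let step : Set E → Set E := fun S => S ∪
    (⋃ q : ℚ, ⋃ x ∈ S, ⋃ y ∈ S, {(q : ℝ) • x + y}) ∪ ⋃ x ∈ S, ⋃ y ∈ S, ⋃ z ∈ S, Φ x y z
  have hstep : ∀ S : Set E, S.Countable → (step S).Countable := by
    intro S hS
    refine (hS.union (countable_iUnion fun q => hS.biUnion fun x _ => hS.biUnion fun y _ =>
      countable_singleton _)).union (hS.biUnion fun x _ => hS.biUnion fun y _ =>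
      hS.biUnion fun z _ => hΦ x y z)
  let T : ℕ → Set E := fun n => step^[n] D0
  have hTs : ∀ n, T (n + 1) = step (T n) := fun n => Function.iterate_succ_apply' _ _ _
  have hTmono : Monotone T := by
    refine monotone_nat_of_le_succ fun n => ?_
    rw [hTs]
    exact subset_union_left.trans subset_union_left
  have hTc : ∀ n, (T n).Countable := by
    intro n
    induction n with
    | zero => exact (hCc.image _).insert _
    | succ n ih => rw [hTs]; exact hstep _ ih
  let D : Set E := ⋃ n, T n
  have hDc : D.Countable := countable_iUnion hTc
  have hD0 : (0 : E) ∈ D := mem_iUnion.2 ⟨0, mem_insert _ _⟩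
  have hDlin : ∀ q : ℚ, ∀ x ∈ D, ∀ y ∈ D, (q : ℝ) • x + y ∈ D := by
    intro q x hx y hy
    obtain ⟨n, hn⟩ := mem_iUnion.1 hx
    obtain ⟨m, hm⟩ := mem_iUnion.1 hy
    refine mem_iUnion.2 ⟨max n m + 1, ?_⟩
    rw [hTs]
    refine Or.inl (Or.inr ?_)
    simp only [mem_iUnion]
    exact ⟨q, x, hTmono (le_max_left _ _) hn, y, hTmono (le_max_right _ _) hm, rfl⟩
  have hDΦ : ∀ x ∈ D, ∀ y ∈ D, ∀ z ∈ D, Φ x y z ⊆ D := by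
    intro x hx y hy z hz w hw
    obtain ⟨n, hn⟩ := mem_iUnion.1 hx
    obtain ⟨m, hm⟩ := mem_iUnion.1 hy
    obtain ⟨l, hl⟩ := mem_iUnion.1 hz
    refine mem_iUnion.2 ⟨max (max n m) l + 1, ?_⟩
    rw [hTs]
    refine Or.inr ?_
    simp only [mem_iUnion]
    exact ⟨x, hTmono ((le_max_left _ _).trans (le_max_left _ _)) hn,
      y, hTmono ((le_max_right _ _).trans (le_max_left _ _)) hm,
      z, hTmono (le_max_right _ _) hl, hw⟩
  have hDadd : ∀ x ∈ D, ∀ y ∈ D, x + y ∈ D := fun x hx y hy => by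
    simpa using hDlin 1 x hx y hy
  have hDsm : ∀ c ∈ range ((↑) : ℚ → ℝ), ∀ x ∈ D, c • x ∈ D := by
    rintro _ ⟨q, rfl⟩ x hx
    simpa using hDlin q x hx 0 hD0
  let V : Submodule ℝ E :=
    { carrier := closure D
      zero_mem' := subset_closure hD0
      add_mem' := fun {x y} hx hy => map_mem_closure₂ continuous_add hx hy hDadd
      smul_mem' := fun c x hx => map_mem_closure₂ continuous_smul
        (Rat.denseRange_cast (𝕜 := ℝ) c) hx hDsm }
  have hVD : (V : Set E) = closure D := rfl
  refine ⟨V, hVD ▸ isClosed_closure, ?_, ?_, D, hVD, hD0, hDΦ⟩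
  · have : TopologicalSpace.IsSeparable (V : Set E) := by
      rw [hVD]; exact hDc.isSeparable.closure
    exact this.separableSpace
  · intro x hx
    have h1 : (⟨x, hx⟩ : V₀) ∈ closure C := hCd _
    have h2 : x ∈ closure (Subtype.val '' C) :=
      map_mem_closure continuous_subtype_val h1 fun y hy => mem_image_of_mem _ hy
    refine closure_mono ?_ h2
    exact (subset_insert _ _).trans (subset_iUnion T 0)

/-- Normalised direction from `z`. -/
noncomputable def nrm (z s : E) : E := ‖s - z‖⁻¹ • (s - z)

theorem cone_zero {f : E →L[ℝ] ℝ} {α : ℝ} (hα : 0 ≤ α) {z s : E}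
    (h : α * ‖f‖ < f (nrm z s)) : α * ‖s - z‖ * ‖f‖ < f (s - z) := by
  have hne : s - z ≠ 0 := by
    intro h0
    have h1 : f (nrm z s) = 0 := by simp [nrm, h0]
    have : 0 ≤ α * ‖f‖ := by positivity
    linarith
  have hpos : 0 < ‖s - z‖ := norm_pos_iff.2 hne
  simp only [nrm, map_smul, smul_eq_mul] at h
  rw [inv_mul_eq_div, lt_div_iff₀ hpos] at h
  linarith [h]

theorem cone_nrm {f : E →L[ℝ] ℝ} {α : ℝ} {z s : E}
    (h : α * ‖s - z‖ * ‖f‖ < f (s - z)) : α * ‖f‖ < f (nrm z s) := by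
  have hne : s - z ≠ 0 := by
    intro h0
    simp [h0] at h
  have hpos : 0 < ‖s - z‖ := norm_pos_iff.2 hne
  simp only [nrm, map_smul, smul_eq_mul]
  rw [inv_mul_eq_div, lt_div_iff₀ hpos]
  linarith [h]

theorem mem_image_cone {f : E →L[ℝ] ℝ} {α : ℝ} {z s : E} :
    s ∈ (z + ·) '' ConeSet f α ↔ α * ‖s - z‖ * ‖f‖ < f (s - z) := by
  constructor
  · rintro ⟨c, hc, rfl⟩
    simpa [ConeSet] using hc
  · intro h
    exact ⟨s - z, h, by simp⟩

theorem mem_closure_hull {α : ℝ} {g : E →L[ℝ] ℝ} (hg : g ≠ 0) {S : Set E} {z w : E} (hw : ‖w‖ ≤ α)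
    (h : ∀ f : E →L[ℝ] ℝ, f ≠ 0 → ∃ s ∈ S, α * ‖s - z‖ * ‖f‖ < f (s - z)) :
    w ∈ closure (convexHull ℝ (nrm z '' S)) := by
  by_contra hcon
  obtain ⟨f, u, hfu, huw⟩ := geometric_hahn_banach_closed_point
    (convex_convexHull ℝ (nrm z '' S)).closure isClosed_closure hcon
  by_cases hf : f = 0
  · subst hf
    obtain ⟨s, hs, _⟩ := h g hg
    have := hfu (nrm z s) (subset_closure (subset_convexHull _ _ (mem_image_of_mem _ hs)))
    simp at this huw
    linarith
  obtain ⟨s, hs, hsf⟩ := h f hf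
  have h1 := cone_nrm hsf
  have h2 := hfu (nrm z s) (subset_closure (subset_convexHull _ _ (mem_image_of_mem _ hs)))
  have h3 : f w ≤ ‖f‖ * ‖w‖ := (le_abs_self _).trans (f.le_opNorm w)
  have h4 : ‖f‖ * ‖w‖ ≤ ‖f‖ * α := by gcongr
  linarith

theorem exists_countable_hull {S : Set E} {z w : E}
    (h : w ∈ closure (convexHull ℝ (nrm z '' S))) :
    ∃ S0 : Set E, S0.Countable ∧ S0 ⊆ S ∧ w ∈ closure (convexHull ℝ (nrm z '' S0)) := by
  have key : ∀ n : ℕ, ∃ F : Set E, F.Countable ∧ F ⊆ S ∧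
      ∃ v ∈ convexHull ℝ (nrm z '' F), dist w v < 1 / ((n : ℝ) + 1) := by
    intro n
    obtain ⟨v, hv, hd⟩ := Metric.mem_closure_iff.1 h (1 / ((n : ℝ) + 1)) (by positivity)
    rw [convexHull_eq_union_convexHull_finite_subsets] at hv
    simp only [mem_iUnion] at hv
    obtain ⟨t, ht, hv⟩ := hv
    obtain ⟨F, hFS, hFb⟩ := subset_image_iff.1 ht
    choose! c hc hc' using fun y (hy : y ∈ t) => ht hy
    refine ⟨c '' t, t.countable_toSet.image _, ?_, v, ?_, hd⟩
    · rintro _ ⟨y, hy, rfl⟩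
      exact hc y hy
    · refine convexHull_mono ?_ hv
      intro y hy
      exact ⟨c y, mem_image_of_mem _ hy, hc' y hy⟩
  choose F hFc hFS v hv hd using key
  refine ⟨⋃ n, F n, countable_iUnion hFc, iUnion_subset hFS, ?_⟩
  refine Metric.mem_closure_iff.2 fun ε hε => ?_
  obtain ⟨n, hn⟩ := exists_nat_one_div_lt hε
  exact ⟨v n, convexHull_mono (image_mono (subset_iUnion F n)) (hv n), (hd n).trans hn⟩


theorem clm_norm_zero {f : E →L[ℝ] ℝ} (h : f = 0) : ‖f‖ = 0 := by rw [h, norm_zero]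

theorem clm_norm_pos {f : E →L[ℝ] ℝ} (h : f ≠ 0) : 0 < ‖f‖ := norm_pos_iff.2 h

theorem case_small {A : Set E} (hA : ConeSmall A)
    (V₀ : Submodule ℝ E) (hV₀ : TopologicalSpace.SeparableSpace V₀) :
    ∃ V : Submodule ℝ E, IsClosed (V : Set E) ∧ TopologicalSpace.SeparableSpace V ∧ V₀ ≤ V ∧
      ConeSmall ((Subtype.val ⁻¹' A) : Set V) := by
  have hk : ∀ k : ℕ, SigmaConePorous (1 / ((k : ℝ) + 2)) A := fun k => hA _
    ⟨by positivity, by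
      have : (0 : ℝ) ≤ k := Nat.cast_nonneg k
      rw [div_lt_one (by positivity)]; linarith⟩
  choose g hg hgA using hk
  let Q : ℕ → ℕ → ℕ → ℕ → E → E × E → Prop := fun k n j m y p =>
    p.1 ∈ ball y (2 * (1 / ((m : ℝ) + 1))) ∧ ∃ f : E →L[ℝ] ℝ, f ≠ 0 ∧ p.2 ≠ 0 ∧
      1 / 2 * ‖f‖ * ‖p.2‖ ≤ f p.2 ∧
      ball y (1 / ((j : ℝ) + 1)) ∩ ((p.1 + ·) '' ConeSet f (1 / ((k : ℝ) + 2))) ∩ g k n = ∅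
  have hQ : ∀ k n j m y, ∃ p, (∃ p', Q k n j m y p') → Q k n j m y p := by
    intro k n j m y
    by_cases h : ∃ p', Q k n j m y p'
    · exact ⟨h.choose, fun _ => h.choose_spec⟩
    · exact ⟨0, fun h' => absurd h' h⟩
  choose p hp using hQ
  let Φ : E → E → E → Set E := fun y _ _ =>
    ⋃ k, ⋃ n, ⋃ j, ⋃ m, {(p k n j m y).1, (p k n j m y).2}
  have hΦ : ∀ x y z, (Φ x y z).Countable := fun x y z =>
    countable_iUnion fun k => countable_iUnion fun n => countable_iUnion fun j =>
      countable_iUnion fun m => ((countable_singleton _).insert _)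
  obtain ⟨V, hVc, hVs, hV0, D, hVD, hD0, hDΦ⟩ := closing_off Φ hΦ V₀ hV₀
  refine ⟨V, hVc, hVs, hV0, ?_⟩
  have hDV : D ⊆ V := hVD ▸ subset_closure
  have hpD : ∀ k n j m, ∀ y ∈ D, (p k n j m y).1 ∈ D ∧ (p k n j m y).2 ∈ D := by
    intro k n j m y hy
    have h := hDΦ y hy y hy y hy
    constructor <;> apply h <;> simp only [Φ, mem_iUnion] <;> exact ⟨k, n, j, m, by simp⟩
  rintro β ⟨hβ0, hβ1⟩
  obtain ⟨k, hk⟩ := exists_nat_one_div_lt (half_pos hβ0)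
  have hkβ : 1 / ((k : ℝ) + 2) ≤ β / 2 :=
    le_trans (one_div_le_one_div_of_le (by positivity) (by linarith)) hk.le
  refine .of_subset_iUnion (g := fun n => Subtype.val ⁻¹' (g k n)) (fun n => ?_) ?_
  swap
  · intro x hx
    have : x.1 ∈ ⋃ n, g k n := hgA k ▸ hx
    simpa using this
  rintro ⟨x, hxV⟩ hx
  obtain ⟨R, hR, hpor⟩ := hg k n x hx
  obtain ⟨j, hj⟩ := exists_nat_one_div_lt (half_pos hR)
  set ρ : ℝ := 1 / ((j : ℝ) + 1) with hρ
  have hρ0 : 0 < ρ := by positivity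
  refine ⟨ρ / 2, half_pos hρ0, fun ε hε => ?_⟩
  obtain ⟨m, hm⟩ := exists_nat_one_div_lt (lt_min (half_pos hρ0) (by linarith : 0 < ε / 4))
  set δ : ℝ := 1 / ((m : ℝ) + 1) with hδ
  have hδ0 : 0 < δ := by positivity
  have hδ1 : δ < ρ / 2 := hm.trans_le (min_le_left _ _)
  have hδ2 : δ < ε / 4 := hm.trans_le (min_le_right _ _)
  have hxc : x ∈ closure D := hVD ▸ hxV
  obtain ⟨y, hyD, hxy⟩ := Metric.mem_closure_iff.1 hxc δ hδ0
  have hex : ∃ p', Q k n j m y p' := by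
    obtain ⟨z, hz, f, hf, he⟩ := hpor δ hδ0
    have : ∃ w, w ≠ 0 ∧ 1 / 2 * ‖f‖ * ‖w‖ ≤ f w := by
      by_contra! hcon
      apply hf
      have hfn : ‖f‖ ≤ 1 / 2 * ‖f‖ := by
        refine f.opNorm_le_bound (by positivity) fun w => ?_
        by_cases hw : w = 0
        · simp [hw]
        · have h1 := hcon w hw
          have h2 := hcon (-w) (neg_ne_zero.2 hw)
          rw [map_neg, norm_neg] at h2
          rw [Real.norm_eq_abs, abs_le]
          constructor <;> linarith
      have : ‖f‖ = 0 := le_antisymm (by linarith) (norm_nonneg _)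
      exact norm_eq_zero.1 this
    obtain ⟨w, hw, hfw⟩ := this
    refine ⟨(z, w), ?_, f, hf, hw, hfw, ?_⟩
    · rw [mem_ball] at hz ⊢
      have := dist_triangle z x y
      linarith
    · refine subset_eq_empty (inter_subset_inter_left _ (inter_subset_inter_left _ ?_)) he
      refine ball_subset_ball' ?_
      rw [dist_comm]
      linarith
  obtain ⟨hz, f, hf, hw, hfw, he⟩ := hp k n j m y hex
  obtain ⟨hzD, hwD⟩ := hpD k n j m y hyD
  set z := (p k n j m y).1
  set w := (p k n j m y).2
  let fV : V →L[ℝ] ℝ := f.comp V.subtypeL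
  have hfV : ∀ v : V, fV v = f v.1 := fun v => rfl
  have hwpos : 0 < ‖w‖ := norm_pos_iff.2 hw
  have hfpos : 0 < ‖f‖ := norm_pos_iff.2 hf
  have hnorm : 1 / 2 * ‖f‖ ≤ ‖fV‖ := by
    have h1 : fV ⟨w, hDV hwD⟩ ≤ ‖fV‖ * ‖w‖ := (le_abs_self _).trans (fV.le_opNorm _)
    have h2 : 1 / 2 * ‖f‖ * ‖w‖ ≤ ‖fV‖ * ‖w‖ := hfw.trans h1
    exact le_of_mul_le_mul_right h2 hwpos
  refine ⟨⟨z, hDV hzD⟩, ?_, fV, ?_, ?_⟩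
  · rw [mem_ball] at hz ⊢
    have := dist_triangle z y x
    rw [dist_comm y x] at this
    change dist z x < ε
    linarith
  · intro h0
    have h1 : ‖fV‖ = 0 := clm_norm_zero h0
    linarith
  · rw [eq_empty_iff_forall_notMem] at he ⊢
    rintro ⟨s, hsV⟩ ⟨⟨hs1, hs2⟩, hs3⟩
    refine he s ⟨⟨?_, ?_⟩, hs3⟩
    · have hs1' : dist s x < ρ / 2 := hs1
      have := dist_triangle s x y
      rw [mem_ball]
      linarith
    · rw [mem_image_cone] at hs2 ⊢
      have hs2' : β * ‖s - z‖ * ‖fV‖ < f (s - z) := hs2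
      refine lt_of_le_of_lt ?_ hs2'
      calc 1 / ((k : ℝ) + 2) * ‖s - z‖ * ‖f‖ ≤ β / 2 * ‖s - z‖ * ‖f‖ := by gcongr
        _ = β * ‖s - z‖ * (1 / 2 * ‖f‖) := by ring
        _ ≤ β * ‖s - z‖ * ‖fV‖ := by gcongr

theorem cone_trans {f : E →L[ℝ] ℝ} {α : ℝ} (hα : 0 ≤ α) {z z' s : E}
    (h1 : α * ‖z' - z‖ * ‖f‖ < f (z' - z)) (h2 : α * ‖s - z'‖ * ‖f‖ < f (s - z')) :
    α * ‖s - z‖ * ‖f‖ < f (s - z) := by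
  have e : s - z = (s - z') + (z' - z) := by abel
  have h3 : α * ‖s - z‖ * ‖f‖ ≤ α * (‖s - z'‖ + ‖z' - z‖) * ‖f‖ := by
    have : ‖s - z‖ ≤ ‖s - z'‖ + ‖z' - z‖ := by rw [e]; exact norm_add_le _ _
    gcongr
  have h4 : f (s - z) = f (s - z') + f (z' - z) := by rw [e, map_add]
  nlinarith

theorem exists_cone_dir {f : E →L[ℝ] ℝ} (hf : f ≠ 0) {α : ℝ} (hα : 0 < α) (hα1 : α < 1) :
    ∃ v : E, α * ‖v‖ * ‖f‖ < f v := by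
  by_contra! hcon
  apply hf
  have hfn : ‖f‖ ≤ α * ‖f‖ := by
    refine f.opNorm_le_bound (by positivity) fun w => ?_
    have h1 := hcon w
    have h2 := hcon (-w)
    rw [map_neg, norm_neg] at h2
    rw [Real.norm_eq_abs, abs_le]
    constructor <;> linarith
  have : ‖f‖ = 0 := by
    have := norm_nonneg f
    nlinarith
  exact norm_eq_zero.1 this

theorem isOpen_cone (f : E →L[ℝ] ℝ) (α : ℝ) (z : E) :
    IsOpen {s | α * ‖s - z‖ * ‖f‖ < f (s - z)} :=
  isOpen_lt (by fun_prop) (by fun_prop)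

/-- Non-porosity transfers to the subspace. -/
theorem hit {α : ℝ} (hα : 0 < α) (hα1 : α < 1) {V : Submodule ℝ E} {D : Set E}
    (hVD : (V : Set E) = closure D) {S : Set E}
    (hS : ∀ z ∈ D, ∀ w ∈ D, w ∈ closure (convexHull ℝ (nrm z '' S)) →
      w ∈ closure (convexHull ℝ (nrm z '' (S ∩ D)))) {x : E} {ε : ℝ}
    (hε : ∀ z ∈ ball x ε, ∀ f : E →L[ℝ] ℝ, f ≠ 0 →
      ∃ s ∈ S, α * ‖s - z‖ * ‖f‖ < f (s - z)) (z : V) (hz : z.1 ∈ ball x ε)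
    (f : V →L[ℝ] ℝ) (hf : f ≠ 0) :
    ∃ s : V, s.1 ∈ S ∧ α / 2 * ‖s - z‖ * ‖f‖ < f (s - z) := by
  have hDV : D ⊆ V := hVD ▸ subset_closure
  have hdense : ∀ U : Set V, IsOpen U → U.Nonempty → ∃ y : V, y ∈ U ∧ y.1 ∈ D := by
    rintro U hU ⟨u, hu⟩
    obtain ⟨r, hr, hrU⟩ := Metric.isOpen_iff.1 hU u hu
    have huc : u.1 ∈ closure D := hVD ▸ u.2
    obtain ⟨y, hy, hd⟩ := Metric.mem_closure_iff.1 huc r hr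
    refine ⟨⟨y, hDV hy⟩, hrU ?_, hy⟩
    rw [mem_ball, dist_comm]
    exact hd
  have hfpos : 0 < ‖f‖ := clm_norm_pos hf
  -- shift the vertex into `D`
  obtain ⟨v, hv⟩ := exists_cone_dir hf (half_pos hα) (by linarith)
  have hU1 : IsOpen ({s : V | α / 2 * ‖s - z‖ * ‖f‖ < f (s - z)} ∩ Subtype.val ⁻¹' ball x ε) :=
    (isOpen_cone f _ z).inter (isOpen_ball.preimage continuous_subtype_val)
  have hU1n : ({s : V | α / 2 * ‖s - z‖ * ‖f‖ < f (s - z)} ∩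
      Subtype.val ⁻¹' ball x ε).Nonempty := by
    have hc : Tendsto (fun t : ℝ => z.1 + t • v.1) (𝓝[>] 0) (𝓝 (z.1 + (0 : ℝ) • v.1)) := by
      refine Tendsto.mono_left ?_ nhdsWithin_le_nhds
      exact Continuous.tendsto (by fun_prop) 0
    rw [zero_smul, add_zero] at hc
    have hev := hc.eventually (isOpen_ball.mem_nhds hz)
    obtain ⟨t, ht, ht0⟩ := (hev.and self_mem_nhdsWithin).exists
    refine ⟨z + t • v, ?_, ht⟩
    have ht0' : 0 < t := ht0
    simp only [mem_ofPred_eq, add_sub_cancel_left, map_smul, norm_smul, Real.norm_eq_abs,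
      abs_of_pos ht0', smul_eq_mul]
    nlinarith
  obtain ⟨z', ⟨hz'c, hz'b⟩, hz'D⟩ := hdense _ hU1 hU1n
  -- choose an almost norming vector in `D`
  obtain ⟨u, hu⟩ := exists_cone_dir hf (by norm_num : (0 : ℝ) < 3 / 4) (by norm_num)
  have hu0 : 0 < ‖u‖ := by
    rw [norm_pos_iff]
    rintro rfl
    simp at hu
  have hU2 : IsOpen {w : V | ‖w‖ < α ∧ α / 2 * ‖f‖ < f w} :=
    IsOpen.and (isOpen_lt continuous_norm continuous_const)
      (isOpen_lt continuous_const f.continuous)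
  have hU2n : {w : V | ‖w‖ < α ∧ α / 2 * ‖f‖ < f w}.Nonempty := by
    refine ⟨(3 / 4 * α * ‖u‖⁻¹) • u, ?_, ?_⟩
    · rw [norm_smul, Real.norm_of_nonneg (by positivity), mul_assoc, inv_mul_cancel₀ hu0.ne']
      linarith
    · rw [map_smul, smul_eq_mul]
      have h1 : 3 / 4 * ‖f‖ < ‖u‖⁻¹ * f u := by
        rw [inv_mul_eq_div, lt_div_iff₀ hu0]
        linarith
      have h2 : 3 / 4 * α * (3 / 4 * ‖f‖) < 3 / 4 * α * (‖u‖⁻¹ * f u) := by gcongr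
      nlinarith [mul_pos hα hfpos]
  obtain ⟨w, ⟨hwn, hwf⟩, hwD⟩ := hdense _ hU2 hU2n
  obtain ⟨F, hF, hFn⟩ := exists_extension_norm_eq V f
  have hF0 : F ≠ 0 := by
    rintro rfl
    rw [norm_zero] at hFn
    linarith
  have hmem := hS z'.1 hz'D w.1 hwD (mem_closure_hull hF0 (α := α) hwn.le (hε z'.1 hz'b))
  have : ∃ s ∈ S ∩ D, α / 2 * ‖F‖ < F (nrm z'.1 s) := by
    by_contra! hcon
    have hsub : closure (convexHull ℝ (nrm z'.1 '' (S ∩ D))) ⊆ {y | F y ≤ α / 2 * ‖F‖} := by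
      refine closure_minimal (convexHull_min ?_ ?_) (isClosed_le (by fun_prop) (by fun_prop))
      · rintro _ ⟨s, hs, rfl⟩
        exact hcon s hs
      · exact convex_halfSpace_le F.toLinearMap.isLinear _
    have h1 : F w.1 ≤ α / 2 * ‖F‖ := hsub hmem
    rw [hF, hFn] at h1
    linarith
  obtain ⟨s, ⟨hsS, hsD⟩, hs⟩ := this
  have hs' := cone_zero (half_pos hα).le hs
  refine ⟨⟨s, hDV hsD⟩, hsS, cone_trans (half_pos hα).le hz'c ?_⟩
  have h5 : f (⟨s, hDV hsD⟩ - z') = F (s - z'.1) := (hF _).symm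
  rw [h5, ← hFn]
  exact hs'

theorem case_not_small [CompleteSpace E] {S : List ℕ → Set E} (hS : ∀ s, IsClosed (S s))
    (hA : ¬ ConeSmall (SuslinOp S))
    (V₀ : Submodule ℝ E) (hV₀ : TopologicalSpace.SeparableSpace V₀) :
    ∃ V : Submodule ℝ E, IsClosed (V : Set E) ∧ TopologicalSpace.SeparableSpace V ∧ V₀ ≤ V ∧
      ¬ ConeSmall ((Subtype.val ⁻¹' (SuslinOp S)) : Set V) := by
  unfold ConeSmall at hA
  push Not at hA
  obtain ⟨α, ⟨hα0, hα1⟩, hσ⟩ := hA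
  let T : List ℕ → Set E := fun t => porKer α (tr α S t)
  have hTsub : ∀ k t, T (k :: t) ⊆ T t := fun k t x hx => hx.1.1.1
  have hTnp : ∀ k t, ∀ x ∈ T (k :: t), ¬ ConePorousAt α (T t) x := fun k t x hx => hx.1.1.2
  have hTS : ∀ t, T t ⊆ S t.reverse := fun t x hx => susSub_subset S t (tr_subset α S t hx.1)
  have hT0 : (T []).Nonempty := by
    by_contra! hcon
    apply hσ
    have := sigma_diff_porKer α (tr α S [])
    change SigmaConePorous α (tr α S [] \ T []) at this
    rw [hcon, sdiff_empty] at this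
    rw [← susSub_nil]
    exact this
  obtain ⟨p0, hp0⟩ := hT0
  -- choice functions
  have h1 : ∀ (t : List ℕ) (j : ℕ) (y : E), ∃ p,
      (T t ∩ ball y (1 / ((j : ℝ) + 1))).Nonempty → p ∈ T t ∩ ball y (1 / ((j : ℝ) + 1)) := by
    intro t j y
    by_cases h : (T t ∩ ball y (1 / ((j : ℝ) + 1))).Nonempty
    · exact ⟨h.some, fun _ => h.some_mem⟩
    · exact ⟨0, fun h' => absurd h' h⟩
  have h2 : ∀ (t : List ℕ) (j : ℕ) (y z w : E), ∃ S0 : Set E, S0.Countable ∧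
      S0 ⊆ T t ∩ ball y (1 / ((j : ℝ) + 1)) ∧
      (w ∈ closure (convexHull ℝ (nrm z '' (T t ∩ ball y (1 / ((j : ℝ) + 1))))) →
        w ∈ closure (convexHull ℝ (nrm z '' S0))) := by
    intro t j y z w
    by_cases h : w ∈ closure (convexHull ℝ (nrm z '' (T t ∩ ball y (1 / ((j : ℝ) + 1)))))
    · obtain ⟨S0, ha, hb, hc⟩ := exists_countable_hull h
      exact ⟨S0, ha, hb, fun _ => hc⟩
    · exact ⟨∅, countable_empty, empty_subset _, fun h' => absurd h' h⟩
  choose pt hpt using h1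
  choose cs hcsc hcss hcsh using h2
  let Φ : E → E → E → Set E := fun y z w =>
    insert p0 ((⋃ t, ⋃ j, {pt t j y}) ∪ ⋃ t, ⋃ j, cs t j y z w)
  have hΦ : ∀ x y z, (Φ x y z).Countable := fun x y z =>
    ((countable_iUnion fun t => countable_iUnion fun j => countable_singleton _).union
      (countable_iUnion fun t => countable_iUnion fun j => hcsc t j x y z)).insert _
  obtain ⟨V, hVc, hVs, hV0, D, hVD, hD0, hDΦ⟩ := closing_off Φ hΦ V₀ hV₀
  refine ⟨V, hVc, hVs, hV0, ?_⟩
  have hDV : D ⊆ V := hVD ▸ subset_closure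
  have hp0D : p0 ∈ D := hDΦ 0 hD0 0 hD0 0 hD0 (mem_insert _ _)
  have hptD : ∀ t j, ∀ y ∈ D, pt t j y ∈ D := by
    intro t j y hy
    refine hDΦ y hy y hy y hy (Or.inr (Or.inl ?_))
    simp only [mem_iUnion]
    exact ⟨t, j, rfl⟩
  have hcsD : ∀ t j, ∀ y ∈ D, ∀ z ∈ D, ∀ w ∈ D, cs t j y z w ⊆ D := by
    intro t j y hy z hz w hw p hp
    refine hDΦ y hy z hz w hw (Or.inr (Or.inr ?_))
    simp only [mem_iUnion]
    exact ⟨t, j, hp⟩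
  intro hsmall
  obtain ⟨P, hP, hPA⟩ := hsmall (α / 2) ⟨by linarith, by linarith⟩
  let Q : ℕ → Set E := fun n => Subtype.val '' P n
  -- the basic step of the construction
  let State := {σ : List ℕ × E × ℝ // σ.2.1 ∈ T σ.1 ∧ σ.2.1 ∈ D ∧ 0 < σ.2.2}
  have step : ∀ (n : ℕ) (σ : State), ∃ σ' : State,
      (∃ k, σ'.1.1 = k :: σ.1.1) ∧
      closedBall σ'.1.2.1 σ'.1.2.2 ⊆ ball σ.1.2.1 σ.1.2.2 ∧
      σ'.1.2.2 ≤ 1 / ((n : ℝ) + 1) ∧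
      (∀ x ∈ closedBall σ'.1.2.1 σ'.1.2.2, ∃ ε > 0, ∀ z ∈ ball x ε, ∀ f : E →L[ℝ] ℝ, f ≠ 0 →
        ∃ s ∈ T σ.1.1 ∩ ball x (2 * (1 / ((n : ℝ) + 1))), α * ‖s - z‖ * ‖f‖ < f (s - z)) ∧
      (closedBall σ'.1.2.1 σ'.1.2.2 ∩ Q n = ∅ ∨
        ∀ p ∈ T σ.1.1, p ∈ V → p ∈ ball σ.1.2.1 σ.1.2.2 → p ∈ closure (Q n)) := by
    rintro n ⟨⟨t, x, r⟩, hxT, hxD, hr⟩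
    dsimp only at hxT hxD hr ⊢
    have hU : ∃ U : Set E, IsOpen U ∧ U ⊆ ball x r ∧ (∃ p ∈ U, p ∈ T t ∧ p ∈ V) ∧
        (U ∩ Q n = ∅ ∨ ∀ p ∈ T t, p ∈ V → p ∈ ball x r → p ∈ closure (Q n)) := by
      by_cases hd : ∀ p ∈ T t, p ∈ V → p ∈ ball x r → p ∈ closure (Q n)
      · exact ⟨ball x r, isOpen_ball, subset_rfl, ⟨x, mem_ball_self hr, hxT, hDV hxD⟩, Or.inr hd⟩
      · push Not at hd
        obtain ⟨p, hpT, hpV, hpb, hpc⟩ := hd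
        refine ⟨ball x r ∩ (closure (Q n))ᶜ, isOpen_ball.inter isClosed_closure.isOpen_compl,
          inter_subset_left, ⟨p, ⟨hpb, hpc⟩, hpT, hpV⟩, Or.inl ?_⟩
        rw [eq_empty_iff_forall_notMem]
        rintro q ⟨⟨_, hq⟩, hq'⟩
        exact hq (subset_closure hq')
    obtain ⟨U, hUo, hUb, ⟨p, hpU, hpT, hpV⟩, hUQ⟩ := hU
    obtain ⟨ρ, hρ, hρU⟩ := Metric.isOpen_iff.1 hUo p hpU
    obtain ⟨j, hj⟩ := exists_nat_one_div_lt (half_pos hρ)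
    have hj0 : 0 < 1 / ((j : ℝ) + 1) := by positivity
    have hpc : p ∈ closure D := hVD ▸ hpV
    obtain ⟨y, hyD, hpy⟩ := Metric.mem_closure_iff.1 hpc _ hj0
    have hyU : ball y (1 / ((j : ℝ) + 1)) ⊆ U := by
      refine (ball_subset_ball' ?_).trans hρU
      rw [dist_comm]
      linarith
    obtain ⟨k, hk⟩ := tr_next α S t hpT (isOpen_ball (x := y) (ε := 1 / ((j : ℝ) + 1)))
      (mem_ball.2 hpy)
    have hq := hpt (k :: t) j y (by rw [inter_comm]; exact hk)
    have hqD := hptD (k :: t) j y hyD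
    set q := pt (k :: t) j y
    have hnp := hTnp k t q hq.1
    unfold ConePorousAt at hnp
    push Not at hnp
    obtain ⟨ε, hε, hnp⟩ := hnp (1 / ((n : ℝ) + 1)) (by positivity)
    obtain ⟨δ, hδ, hδU⟩ := Metric.isOpen_iff.1 hUo q (hyU hq.2)
    have hn0 : 0 < 1 / ((n : ℝ) + 1) := by positivity
    obtain ⟨r', hr'0, hr'⟩ := exists_between (lt_min (lt_min hδ hn0) (half_pos hε))
    have hr1 : r' < δ := hr'.trans_le ((min_le_left _ _).trans (min_le_left _ _))
    have hr2 : r' < 1 / ((n : ℝ) + 1) := hr'.trans_le ((min_le_left _ _).trans (min_le_right _ _))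
    have hr3 : r' < ε / 2 := hr'.trans_le (min_le_right _ _)
    have hcb : closedBall q r' ⊆ U := (closedBall_subset_ball hr1).trans hδU
    refine ⟨⟨(k :: t, q, r'), hq.1, hqD, hr'0⟩, ⟨k, rfl⟩, hcb.trans hUb, hr2.le, ?_, ?_⟩
    · intro x' hx'
      have hx'd : dist x' q ≤ r' := hx'
      refine ⟨ε / 2, half_pos hε, fun z hz f hf => ?_⟩
      have hzq : z ∈ ball q ε := by
        rw [mem_ball] at hz ⊢
        have := dist_triangle z x' q
        linarith
      obtain ⟨s, ⟨hs1, hs2⟩, hs3⟩ := hnp z hzq f hf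
      refine ⟨s, ⟨hs3, ?_⟩, mem_image_cone.1 hs2⟩
      rw [mem_ball] at hs1 ⊢
      have := dist_triangle s q x'
      rw [dist_comm q x'] at this
      linarith
    · rcases hUQ with h | h
      · exact Or.inl (subset_eq_empty (inter_subset_inter_left _ hcb) h)
      · exact Or.inr h
  choose nx hk hball hrad hhit halt using step
  let seq : ℕ → State := fun n => Nat.rec ⟨([], p0, 1), hp0, hp0D, one_pos⟩ nx n
  have hseq : ∀ n, seq (n + 1) = nx n (seq n) := fun n => rfl
  have hseq0 : (seq 0).1.1 = [] := rfl
  choose kk hkk using fun n => hk n (seq n)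
  let B : ℕ → Set E := fun n => closedBall (seq n).1.2.1 (seq n).1.2.2
  have hBanti : Antitone B := antitone_nat_of_succ_le fun n =>
    (hball n (seq n)).trans ball_subset_closedBall
  have hTanti : Antitone fun n => T (seq n).1.1 := by
    refine antitone_nat_of_succ_le fun n => ?_
    rw [hseq, hkk n]
    exact hTsub _ _
  have hcB : ∀ n m, n ≤ m → (seq m).1.2.1 ∈ B n := fun n m h =>
    hBanti h (mem_closedBall_self (seq m).2.2.2.le)
  have hcau : CauchySeq fun n => (seq n).1.2.1 := by
    rw [Metric.cauchySeq_iff']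
    intro ε hε
    obtain ⟨N, hN⟩ := exists_nat_one_div_lt hε
    refine ⟨N + 1, fun n hn => ?_⟩
    have h1 : dist (seq n).1.2.1 (seq (N + 1)).1.2.1 ≤ (seq (N + 1)).1.2.2 := hcB _ _ hn
    exact (h1.trans (hrad N (seq N))).trans_lt hN
  obtain ⟨x, hx⟩ := cauchySeq_tendsto_of_complete hcau
  have hxB : ∀ n, x ∈ B n := fun n => isClosed_closedBall.mem_of_tendsto hx
    (eventually_atTop.2 ⟨n, fun m hm => hcB n m hm⟩)
  have hxV : x ∈ V := hVc.mem_of_tendsto hx (Eventually.of_forall fun n => hDV (seq n).2.2.1)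
  have hrev : ∀ n, (seq n).1.1.reverse = seg kk n := by
    intro n
    induction n with
    | zero => rw [hseq0]; rfl
    | succ n ih => rw [hseq, hkk n, List.reverse_cons, ih, seg_succ]
  have hxA : x ∈ SuslinOp S := by
    refine mem_iUnion.2 ⟨kk, mem_iInter.2 fun n => ?_⟩
    refine (hS _).mem_of_tendsto hx (eventually_atTop.2 ⟨n, fun m hm => ?_⟩)
    rw [← hrev n]
    exact hTS _ (hTanti hm (seq m).2.1)
  have hxP : (⟨x, hxV⟩ : V) ∈ ⋃ n, P n := hPA ▸ hxA
  obtain ⟨n, hn⟩ := mem_iUnion.1 hxP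
  rcases halt n (seq n) with h | h
  · exact h.subset ⟨hxB (n + 1), ⟨_, hn, rfl⟩⟩
  -- non-porosity of `P n` at `x`
  obtain ⟨R, hR, hpor⟩ := hP n _ hn
  have hxb : x ∈ ball (seq n).1.2.1 (seq n).1.2.2 := hball n (seq n) (hxB (n + 1))
  obtain ⟨R₁, hR₁, hR₁b⟩ := Metric.isOpen_iff.1 isOpen_ball x hxb
  obtain ⟨j, hj⟩ := exists_nat_one_div_lt (half_pos (lt_min hR hR₁))
  set ρ : ℝ := 1 / ((j : ℝ) + 1) with hρ
  have hρ0 : 0 < ρ := by positivity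
  have hxc : x ∈ closure D := hVD ▸ hxV
  obtain ⟨y, hyD, hxy⟩ := Metric.mem_closure_iff.1 hxc (ρ / 2) (half_pos hρ0)
  have hyR : ball y ρ ⊆ ball x (min R R₁) := by
    refine ball_subset_ball' ?_
    rw [dist_comm]
    linarith
  obtain ⟨m₀, hm₀⟩ := exists_nat_one_div_lt (by linarith : 0 < ρ / 4)
  set m := max n m₀
  have hm : 1 / ((m : ℝ) + 1) < ρ / 4 := by
    refine lt_of_le_of_lt (one_div_le_one_div_of_le (by positivity) ?_) hm₀
    have : (m₀ : ℝ) ≤ m := by exact_mod_cast le_max_right n m₀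
    linarith
  obtain ⟨ε, hε, hhit'⟩ := hhit m (seq m) x (hxB (m + 1))
  obtain ⟨z, hz, f, hf, he⟩ := hpor ε hε
  obtain ⟨s, hsS, hsc⟩ := hit hα0 hα1 hVD (S := T (seq m).1.1 ∩ ball y ρ) (x := x) (ε := ε)
    (by
      intro z hz w hw hwc
      refine closure_mono (convexHull_mono (image_mono ?_)) (hcsh (seq m).1.1 j y z w hwc)
      exact subset_inter (hcss _ _ _ _ _) (hcsD _ _ y hyD z hz w hw))
    (by
      intro z hz f hf
      obtain ⟨s, ⟨hs1, hs2⟩, hs3⟩ := hhit' z hz f hf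
      refine ⟨s, ⟨hs1, ?_⟩, hs3⟩
      rw [mem_ball] at hs2 ⊢
      have := dist_triangle s x y
      linarith)
    z hz f hf
  have hsx := hyR hsS.2
  have hsn : s.1 ∈ T (seq n).1.1 := hTanti (le_max_left n m₀) hsS.1
  have hsQ := h s.1 hsn s.2 (hR₁b (ball_subset_ball (min_le_right _ _) hsx))
  have hsP : s ∈ closure (P n) := by
    rw [Metric.mem_closure_iff] at hsQ ⊢
    intro δ hδ
    obtain ⟨_, ⟨q, hq, rfl⟩, hd⟩ := hsQ δ hδ
    exact ⟨q, hq, hd⟩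
  have hW : IsOpen (ball (⟨x, hxV⟩ : V) R ∩ {s : V | α / 2 * ‖s - z‖ * ‖f‖ < f (s - z)}) :=
    isOpen_ball.inter (isOpen_cone f _ z)
  have hsW : s ∈ ball (⟨x, hxV⟩ : V) R ∩ {s : V | α / 2 * ‖s - z‖ * ‖f‖ < f (s - z)} :=
    ⟨ball_subset_ball (min_le_left _ _) hsx, hsc⟩
  obtain ⟨q, ⟨hq1, hq2⟩, hqP⟩ := mem_closure_iff.1 hsP _ hW hsW
  exact he.subset ⟨⟨hq1, mem_image_cone.2 hq2⟩, hqP⟩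

end Helpers

/-- Separable determination of cone smallness of Suslin sets in Asplund spaces
(every closed separable subspace has separable dual): for every separable subspace `V₀`
there is a closed separable subspace `V ⊇ V₀` such that `A` is cone small in `X` iff
`A ∩ V` is cone small in `V`. -/
theorem cone_small_separably_determined
    {X : Type*} [NormedAddCommGroup X] [NormedSpace ℝ X] [CompleteSpace X]
    (hAsp : ∀ V : Subspace ℝ X, IsClosed (V : Set X) →
      TopologicalSpace.SeparableSpace V →
      TopologicalSpace.SeparableSpace (StrongDual ℝ V))
    (A : Set X) (hA : IsSuslin A)
    (V₀ : Subspace ℝ X) (hV₀ : TopologicalSpace.SeparableSpace V₀) :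
    ∃ V : Subspace ℝ X, IsClosed (V : Set X) ∧ TopologicalSpace.SeparableSpace V ∧
      V₀ ≤ V ∧ (ConeSmall A ↔ ConeSmall ((Subtype.val ⁻¹' A) : Set V)) := by
  obtain ⟨S, hS, rfl⟩ := hA
  by_cases h : ConeSmall (SuslinOp S)
  · obtain ⟨V, h1, h2, h3, h4⟩ := case_small h V₀ hV₀
    exact ⟨V, h1, h2, h3, iff_of_true h h4⟩
  · obtain ⟨V, h1, h2, h3, h4⟩ := case_not_small hS h V₀ hV₀
    exact ⟨V, h1, h2, h3, iff_of_false h h4⟩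
end
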